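/- Let k be a prime number and let G be a (3k−3)-edge-connected multigraph containing at least k−1 vertices whose degrees are coprime with k. Then G can be edge-decomposed into k spanning subgraphs G_1, …, G_k with | |E(G_i)| − |E(G)|/k | < 1 such that for each vertex v and each i, |d_{G_i}(v) − d_G(v)/k| < 1. -/

import Mathlib

open Finset

variable {V E : Type*}

/-- Degree of `v` in the sub-multigraph given by the edge set `S`,
where `ends e` gives the two endpoints of edge `e` (loops count twice). -/
def mdeg [DecidableEq V] (ends : E → V × V) (S : Finset E) (v : V) : ℕ :=
  (S.filter fun e => (ends e).1 = v).card + (S.filter fun e => (ends e).2 = v).card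

/-- Number of edges with exactly one end in the vertex set `X`. -/
def cutCard [Fintype E] [DecidableEq V] (ends : E → V × V) (X : Finset V) : ℕ :=
  (univ.filter fun e : E =>
    ((ends e).1 ∈ X ∧ (ends e).2 ∉ X) ∨ ((ends e).1 ∉ X ∧ (ends e).2 ∈ X)).card

/-- `lam`-edge-connectedness: every edge cut has at least `lam` edges. -/
def EdgeConn [Fintype V] [Fintype E] [DecidableEq V] (ends : E → V × V) (lam : ℕ) : Prop :=
  ∀ X : Finset V, X.Nonempty → X ≠ univ → lam ≤ cutCard ends X

set_option linter.unusedSectionVars false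
set_option linter.unusedVariables false

structure OD (V E : Type*) where
  ends : E → V × V
  F : Finset E
  U : Finset V
  r : V → ℤ
  a : V → ℤ
  b : V → ℤ

namespace OD

def tl (ends : E → V × V) (o : E → Bool) (e : E) : V :=
  if o e = true then (ends e).1 else (ends e).2

section
variable [DecidableEq V] [DecidableEq E]

def X (I : OD V E) (S : Finset V) : ℤ :=
  ∑ v ∈ S, (I.r v + I.b v) -
    ∑ e ∈ I.F, if (I.ends e).1 ∈ S ∧ (I.ends e).2 ∈ S then 1 else 0

def Y (I : OD V E) (S : Finset V) : ℤ :=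
  ∑ v ∈ S, (I.a v - I.r v) +
    ∑ e ∈ I.F, if (I.ends e).1 ∈ S ∨ (I.ends e).2 ∈ S then 1 else 0

def Good (k j : ℤ) (I : OD V E) (S : Finset V) : Prop :=
  ∃ m : ℤ, j ≤ I.X S + m * k ∧ j ≤ I.Y S - m * k

def Exempt (k : ℤ) (I : OD V E) (S : Finset V) : Prop :=
  ∃ m : ℤ, I.X S + m * k = I.Y S - m * k

def Sol (k : ℤ) (I : OD V E) : Prop :=
  ∃ o : E → Bool, ∀ v ∈ I.U, k ∣ (∑ e ∈ I.F, if tl I.ends o e = v then 1 else 0) - I.r v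

structure Inst (k : ℤ) (I : OD V E) (v0 : V) : Prop where
  endsU : ∀ e ∈ I.F, (I.ends e).1 ∈ I.U ∧ (I.ends e).2 ∈ I.U
  a0 : ∀ v, 0 ≤ I.a v
  b0 : ∀ v, 0 ≤ I.b v
  root : (∑ v ∈ I.U, I.a v ≤ 2 * k - 1 ∧ ∑ v ∈ I.U, I.b v ≤ k - 1) ∨
    (∑ v ∈ I.U, I.a v ≤ k - 1 ∧ ∑ v ∈ I.U, I.b v ≤ 2 * k - 1)
  cong : k ∣ ∑ v ∈ I.U, I.r v - (#I.F : ℤ)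
  good : ∀ S ⊆ I.U, S.Nonempty → S ≠ I.U → Good k (k - 1) I S ∨ (S = {v0} ∧ Exempt k I S)

def lt (J I : OD V E) : Prop :=
  #J.U + #J.F < #I.U + #I.F ∨
  (#J.U + #J.F = #I.U + #I.F ∧ ∑ v ∈ J.U, (J.a v + J.b v) < ∑ v ∈ I.U, (I.a v + I.b v))

/-! ### mirror -/

def dg (I : OD V E) (v : V) : ℤ :=
  ∑ e ∈ I.F, ((if (I.ends e).1 = v then 1 else 0) + (if (I.ends e).2 = v then 1 else 0))

def mirror (I : OD V E) : OD V E :=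
  { I with r := fun v => I.dg v - I.r v, a := I.b, b := I.a }

theorem sum_dg (I : OD V E) (S : Finset V) :
    ∑ v ∈ S, I.dg v = (∑ e ∈ I.F, if (I.ends e).1 ∈ S ∧ (I.ends e).2 ∈ S then 1 else 0) +
      ∑ e ∈ I.F, if (I.ends e).1 ∈ S ∨ (I.ends e).2 ∈ S then 1 else 0 := by
  unfold dg
  rw [Finset.sum_comm, ← Finset.sum_add_distrib]
  refine Finset.sum_congr rfl fun e _ => ?_
  rw [Finset.sum_add_distrib, Finset.sum_ite_eq, Finset.sum_ite_eq]
  by_cases h1 : (I.ends e).1 ∈ S <;> by_cases h2 : (I.ends e).2 ∈ S <;> simp [h1, h2]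

theorem X_mirror (I : OD V E) (S : Finset V) : I.mirror.X S = I.Y S := by
  have := I.sum_dg S
  have e1 : I.mirror.X S = ∑ v ∈ S, (I.dg v - I.r v + I.a v) -
    ∑ e ∈ I.F, if (I.ends e).1 ∈ S ∧ (I.ends e).2 ∈ S then 1 else 0 := rfl
  rw [e1]
  simp only [Y, Finset.sum_add_distrib, Finset.sum_sub_distrib]
  linear_combination this

theorem Y_mirror (I : OD V E) (S : Finset V) : I.mirror.Y S = I.X S := by
  have := I.sum_dg S
  have e1 : I.mirror.Y S = ∑ v ∈ S, (I.b v - (I.dg v - I.r v)) +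
    ∑ e ∈ I.F, if (I.ends e).1 ∈ S ∨ (I.ends e).2 ∈ S then 1 else 0 := rfl
  rw [e1]
  simp only [X, Finset.sum_add_distrib, Finset.sum_sub_distrib]
  linear_combination -this

theorem good_mirror {k j : ℤ} {I : OD V E} {S : Finset V} (h : Good k j I S) :
    Good k j I.mirror S := by
  obtain ⟨m, h1, h2⟩ := h
  refine ⟨-m, ?_, ?_⟩
  · rw [X_mirror]; linarith
  · rw [Y_mirror]; linarith

theorem exempt_mirror {k : ℤ} {I : OD V E} {S : Finset V} (h : Exempt k I S) :
    Exempt k I.mirror S := by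
  obtain ⟨m, h1⟩ := h
  refine ⟨-m, ?_⟩
  rw [X_mirror, Y_mirror]; linarith

theorem inst_mirror {k : ℤ} {I : OD V E} {v0 : V} (h : Inst k I v0) : Inst k I.mirror v0 where
  endsU := h.endsU
  a0 := h.b0
  b0 := h.a0
  root := by
    have := h.root
    simp only [mirror]
    tauto
  cong := by
    have h1 := I.sum_dg I.U
    have e1 : (∑ e ∈ I.F, if (I.ends e).1 ∈ I.U ∧ (I.ends e).2 ∈ I.U then (1:ℤ) else 0) = #I.F := by
      rw [Finset.sum_congr rfl (g := fun _ => (1:ℤ))]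
      · simp
      · intro e he; simp [h.endsU e he]
    have e2 : (∑ e ∈ I.F, if (I.ends e).1 ∈ I.U ∨ (I.ends e).2 ∈ I.U then (1:ℤ) else 0) = #I.F := by
      rw [Finset.sum_congr rfl (g := fun _ => (1:ℤ))]
      · simp
      · intro e he; simp [h.endsU e he]
    rw [e1, e2] at h1
    simp only [mirror, Finset.sum_sub_distrib]
    have := h.cong
    rw [← dvd_neg] at this
    rw [h1]
    refine this.trans (dvd_of_eq ?_)
    ring
  good := fun S h1 h2 h3 => by
    rcases h.good S h1 h2 h3 with h | ⟨h, h'⟩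
    · exact Or.inl (good_mirror h)
    · exact Or.inr ⟨h, exempt_mirror h'⟩

theorem sol_mirror {k : ℤ} {I : OD V E} (h : Sol k I.mirror) : Sol k I := by
  obtain ⟨o, ho⟩ := h
  refine ⟨fun e => !(o e), fun v hv => ?_⟩
  have h0 : k ∣ (∑ e ∈ I.F, if tl I.ends o e = v then 1 else 0) - (I.dg v - I.r v) := ho v hv
  rw [← dvd_neg] at h0
  refine h0.trans (dvd_of_eq ?_)
  simp only [dg]
  have : ∀ e, (if tl I.ends (fun e => !(o e)) e = v then (1:ℤ) else 0) =
    ((if (I.ends e).1 = v then 1 else 0) + (if (I.ends e).2 = v then 1 else 0)) -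
      (if tl I.ends o e = v then (1:ℤ) else 0) := by
    intro e
    unfold tl
    cases h : o e <;> simp [h]
  simp only [this, Finset.sum_sub_distrib]
  ring

theorem lt_mirror {J I : OD V E} (h : lt J I.mirror) : lt J I := by
  unfold lt at *
  simp only [mirror] at h
  simpa only [add_comm (I.a _)] using h

/-! ### orient and delete -/

def Joins (I : OD V E) (e : E) (t h : V) : Prop := I.ends e = (t, h) ∨ I.ends e = (h, t)

def od (I : OD V E) (e : E) (t : V) (a' b' : V → ℤ) : OD V E :=
  { I with F := I.F.erase e, r := fun v => I.r v - if v = t then 1 else 0, a := a', b := b' }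

theorem X_od {I : OD V E} {e : E} {t h : V} (he : e ∈ I.F) (hj : I.Joins e t h)
    (a' b' : V → ℤ) (S : Finset V) :
    (I.od e t a' b').X S = I.X S - (if t ∈ S ∧ h ∉ S then 1 else 0) + ∑ v ∈ S, (b' v - I.b v) := by
  have e1 : (I.od e t a' b').X S = ∑ v ∈ S, (I.r v - (if v = t then 1 else 0) + b' v) -
    ∑ e ∈ I.F.erase e, if (I.ends e).1 ∈ S ∧ (I.ends e).2 ∈ S then 1 else 0 := rfl
  rw [e1]
  simp only [X, Finset.sum_add_distrib, Finset.sum_sub_distrib, Finset.sum_ite_eq']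
  rw [← Finset.add_sum_erase _ _ he]
  rcases hj with hj | hj <;> rw [hj] <;> by_cases h1 : t ∈ S <;> by_cases h2 : h ∈ S <;>
    simp [h1, h2, -Finset.sum_boole] <;> ring

theorem Y_od {I : OD V E} {e : E} {t h : V} (he : e ∈ I.F) (hj : I.Joins e t h)
    (a' b' : V → ℤ) (S : Finset V) :
    (I.od e t a' b').Y S = I.Y S - (if h ∈ S ∧ t ∉ S then 1 else 0) + ∑ v ∈ S, (a' v - I.a v) := by
  have e1 : (I.od e t a' b').Y S = ∑ v ∈ S, (a' v - (I.r v - (if v = t then 1 else 0))) +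
    ∑ e ∈ I.F.erase e, if (I.ends e).1 ∈ S ∨ (I.ends e).2 ∈ S then 1 else 0 := rfl
  rw [e1]
  simp only [Y, Finset.sum_sub_distrib, Finset.sum_ite_eq']
  rw [← Finset.add_sum_erase _ _ he]
  rcases hj with hj | hj <;> rw [hj] <;> by_cases h1 : t ∈ S <;> by_cases h2 : h ∈ S <;>
    simp [h1, h2, -Finset.sum_boole] <;> ring

theorem sol_od {k : ℤ} {I : OD V E} {e : E} {t h : V} (he : e ∈ I.F) (hj : I.Joins e t h)
    {a' b' : V → ℤ} (hs : Sol k (I.od e t a' b')) : Sol k I := by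
  obtain ⟨o, ho⟩ := hs
  obtain ⟨bt, hbt⟩ : ∃ bt : Bool, (if bt = true then (I.ends e).1 else (I.ends e).2) = t := by
    rcases hj with hj | hj
    · exact ⟨true, by simp [hj]⟩
    · exact ⟨false, by simp [hj]⟩
  refine ⟨Function.update o e bt, fun v hv => ?_⟩
  have h1 : k ∣ (∑ x ∈ I.F.erase e, if tl I.ends o x = v then 1 else 0) -
    (I.r v - if v = t then 1 else 0) := ho v hv
  rw [← Finset.add_sum_erase _ _ he]
  have e1 : ∑ x ∈ I.F.erase e, (if tl I.ends (Function.update o e bt) x = v then (1:ℤ) else 0) =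
      ∑ x ∈ I.F.erase e, (if tl I.ends o x = v then (1:ℤ) else 0) := by
    refine Finset.sum_congr rfl fun x hx => ?_
    unfold tl
    rw [Function.update_of_ne (Finset.ne_of_mem_erase hx)]
  have e2 : tl I.ends (Function.update o e bt) e = t := by
    unfold tl; rw [Function.update_self]; exact hbt
  rw [e1, e2]
  refine h1.trans (dvd_of_eq ?_)
  by_cases hvt : v = t
  · subst hvt; simp [-Finset.sum_boole]; ring
  · simp [hvt, Ne.symm hvt, -Finset.sum_boole]

theorem inst_od {k : ℤ} {I : OD V E} {v0 v1 : V} (hI : Inst k I v0) {e : E} {t h : V} (he : e ∈ I.F)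
    (hj : I.Joins e t h) {a' b' : V → ℤ} (ha : ∀ v, 0 ≤ a' v) (hb : ∀ v, 0 ≤ b' v)
    (hroot : (∑ v ∈ I.U, a' v ≤ 2 * k - 1 ∧ ∑ v ∈ I.U, b' v ≤ k - 1) ∨
      (∑ v ∈ I.U, a' v ≤ k - 1 ∧ ∑ v ∈ I.U, b' v ≤ 2 * k - 1))
    (hgood : ∀ S ⊆ I.U, S.Nonempty → S ≠ I.U → Good k (k - 1) (I.od e t a' b') S ∨
      (S = {v1} ∧ Exempt k (I.od e t a' b') S)) : Inst k (I.od e t a' b') v1 where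
  endsU := fun x hx => hI.endsU x (Finset.mem_of_mem_erase hx)
  a0 := ha
  b0 := hb
  root := hroot
  cong := by
    have ht : t ∈ I.U := by
      have := hI.endsU e he
      rcases hj with hj | hj <;> rw [hj] at this
      exacts [this.1, this.2]
    have h1 := hI.cong
    simp only [od, Finset.sum_sub_distrib, Finset.sum_ite_eq', ht, if_true]
    rw [Finset.card_erase_of_mem he, Nat.cast_sub (Finset.card_pos.2 ⟨e, he⟩)]
    convert h1 using 1
    push_cast; ring
  good := hgood

theorem lt_od {I : OD V E} {e : E} {t : V} (he : e ∈ I.F) {a' b' : V → ℤ} :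
    lt (I.od e t a' b') I := by
  left
  have := Finset.card_erase_lt_of_mem he
  simp only [od]; omega

/-! ### contraction -/

def cf (S : Finset V) (s0 : V) (v : V) : V := if v ∈ S then s0 else v
def cT (S : Finset V) (s0 : V) (S' : Finset V) : Finset V := if s0 ∈ S' then S' ∪ S else S'
def cs (S : Finset V) (s0 : V) (g : V → ℤ) (v : V) : ℤ := if v = s0 then ∑ x ∈ S, g x else g v

def con (I : OD V E) (S : Finset V) (s0 : V) : OD V E :=
  { ends := fun e => (cf S s0 (I.ends e).1, cf S s0 (I.ends e).2)
    F := I.F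
    U := insert s0 (I.U \ S)
    r := cs S s0 I.r
    a := cs S s0 I.a
    b := cs S s0 I.b }

theorem cf_mem {S : Finset V} {s0 : V} (hs0 : s0 ∈ S) {S' U : Finset V}
    (hS' : S' ⊆ insert s0 (U \ S)) (v : V) : cf S s0 v ∈ S' ↔ v ∈ cT S s0 S' := by
  unfold cf cT
  have h2 : v ∈ S → v ∈ S' → v = s0 := fun h h' => by
    have := hS' h'
    simp only [Finset.mem_insert, Finset.mem_sdiff] at this
    tauto
  by_cases h : s0 ∈ S' <;> by_cases h1 : v ∈ S <;> simp [h, h1]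
  intro h3
  exact h (h2 h1 h3 ▸ h3)

theorem cs_sum {S : Finset V} {s0 : V} (hs0 : s0 ∈ S) {S' U : Finset V}
    (hS' : S' ⊆ insert s0 (U \ S)) (g : V → ℤ) :
    ∑ v ∈ S', cs S s0 g v = ∑ v ∈ cT S s0 S', g v := by
  unfold cT
  have h2 : ∀ v, v ∈ S → v ∈ S' → v = s0 := fun v h h' => by
    have := hS' h'
    simp only [Finset.mem_insert, Finset.mem_sdiff] at this
    tauto
  have h3 : ∀ T : Finset V, s0 ∉ T → ∑ v ∈ T, cs S s0 g v = ∑ v ∈ T, g v := fun T hT =>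
    Finset.sum_congr rfl fun v hv => by
      unfold cs; rw [if_neg]; rintro rfl; exact hT hv
  split_ifs with h
  · rw [← Finset.add_sum_erase _ _ h, h3 _ (Finset.notMem_erase _ _)]
    have : S' ∪ S = S ∪ S'.erase s0 := by
      ext v; simp only [Finset.mem_union, Finset.mem_erase]
      by_cases hv : v = s0
      · subst hv; tauto
      · tauto
    rw [this, Finset.sum_union]
    · simp [cs]
    · rw [Finset.disjoint_left]
      intro v hv hv'
      rw [Finset.mem_erase] at hv'
      exact hv'.1 (h2 v hv hv'.2)
  · exact h3 _ h

theorem X_con {I : OD V E} {S : Finset V} {s0 : V} (hs0 : s0 ∈ S) {S' : Finset V}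
    (hS' : S' ⊆ insert s0 (I.U \ S)) : (I.con S s0).X S' = I.X (cT S s0 S') := by
  have h1 := cs_sum hs0 hS' I.r
  have h2 := cs_sum hs0 hS' I.b
  simp only [X, con, Finset.sum_add_distrib, cf_mem hs0 hS', h1, h2]

theorem Y_con {I : OD V E} {S : Finset V} {s0 : V} (hs0 : s0 ∈ S) {S' : Finset V}
    (hS' : S' ⊆ insert s0 (I.U \ S)) : (I.con S s0).Y S' = I.Y (cT S s0 S') := by
  have h1 := cs_sum hs0 hS' I.r
  have h2 := cs_sum hs0 hS' I.a
  simp only [Y, con, Finset.sum_sub_distrib, cf_mem hs0 hS', h1, h2]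

theorem cT_U {S U : Finset V} {s0 : V} (hS : S ⊆ U) :
    cT S s0 (insert s0 (U \ S)) = insert s0 U := by
  unfold cT
  rw [if_pos (Finset.mem_insert_self _ _), Finset.insert_union, Finset.sdiff_union_of_subset hS]

theorem tl_con (I : OD V E) (S : Finset V) (s0 : V) (o : E → Bool) (e : E) :
    tl (I.con S s0).ends o e = cf S s0 (tl I.ends o e) := by
  unfold tl con; split_ifs <;> rfl

theorem inst_con {k : ℤ} {I : OD V E} {v0 : V} (hI : Inst k I v0) {S : Finset V} {s0 : V}
    (hs0 : s0 ∈ S) (hS : S ⊆ I.U) (h2 : 2 ≤ #S) : Inst k (I.con S s0) (cf S s0 v0) := by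
  have hU : cT S s0 (insert s0 (I.U \ S)) = I.U := by
    rw [cT_U hS, Finset.insert_eq_of_mem (hS hs0)]
  have sumU : ∀ g : V → ℤ, ∑ v ∈ insert s0 (I.U \ S), cs S s0 g v = ∑ v ∈ I.U, g v := fun g => by
    rw [cs_sum hs0 (U := I.U) (Finset.Subset.refl _), hU]
  have nonneg : ∀ g : V → ℤ, (∀ v, 0 ≤ g v) → ∀ v, 0 ≤ cs S s0 g v := fun g hg v => by
    unfold cs; split_ifs
    · exact Finset.sum_nonneg fun x _ => hg x
    · exact hg v
  have cfU : ∀ v ∈ I.U, cf S s0 v ∈ insert s0 (I.U \ S) := fun v hv => by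
    unfold cf; split_ifs with h <;> simp [h, hv]
  refine ⟨fun e he => ⟨cfU _ (hI.endsU e he).1, cfU _ (hI.endsU e he).2⟩, nonneg _ hI.a0,
    nonneg _ hI.b0, ?_, ?_, ?_⟩
  · simp only [con, sumU]; exact hI.root
  · simp only [con, sumU]; exact hI.cong
  · intro S' hS' hne hneU
    change S' ⊆ insert s0 (I.U \ S) at hS'
    change S' ≠ insert s0 (I.U \ S) at hneU
    have key : ∀ v, cf S s0 v ∈ S' ↔ v ∈ cT S s0 S' := cf_mem hs0 hS'
    have t1 : cT S s0 S' ⊆ I.U := by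
      intro v hv
      by_cases hvS : v ∈ S
      · exact hS hvS
      · have := (key v).2 hv
        unfold cf at this; rw [if_neg hvS] at this
        have := hS' this
        simp only [Finset.mem_insert, Finset.mem_sdiff] at this
        rcases this with h | h
        · exact absurd (h ▸ hs0) hvS
        · exact h.1
    have fix : ∀ x ∈ insert s0 (I.U \ S), cf S s0 x = x := by
      intro x hx
      unfold cf
      simp only [Finset.mem_insert, Finset.mem_sdiff] at hx
      split_ifs with h
      · tauto
      · rfl
    have t2 : (cT S s0 S').Nonempty := by
      obtain ⟨x, hx⟩ := hne
      exact ⟨x, (key x).1 (by rw [fix x (hS' hx)]; exact hx)⟩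
    have t3 : cT S s0 S' ≠ I.U := by
      intro h
      apply hneU
      refine Finset.Subset.antisymm hS' fun x hx => ?_
      have : x ∈ I.U := by
        simp only [Finset.mem_insert, Finset.mem_sdiff] at hx
        rcases hx with rfl | hx
        · exact hS hs0
        · exact hx.1
      rw [← fix x hx, key, h]; exact this
    have hG := hI.good _ t1 t2 t3
    unfold Good Exempt at *
    rw [X_con hs0 hS', Y_con hs0 hS']
    rcases hG with h | ⟨h, h'⟩
    · exact Or.inl h
    · right
      refine ⟨?_, h'⟩
      unfold cT at h
      split_ifs at h with h3
      · have : S ⊆ {v0} := h ▸ Finset.subset_union_right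
        have := Finset.card_le_card this
        simp at this; omega
      · have hv : v0 ∈ S' := by rw [h]; simp
        rw [fix v0 (hS' hv), h]

theorem exists_con {k : ℤ} {I : OD V E} {v0 : V} (hI : Inst k I v0)
    (IH : ∀ (J : OD V E) (v1 : V), lt J I → Inst k J v1 → Sol k J) {S : Finset V}
    (hS : S ⊆ I.U) (h2 : 2 ≤ #S) :
    ∃ o : E → Bool, (∀ v ∈ I.U, v ∉ S →
      k ∣ (∑ e ∈ I.F, if tl I.ends o e = v then 1 else 0) - I.r v) ∧
      k ∣ (∑ e ∈ I.F, if tl I.ends o e ∈ S then 1 else 0) - ∑ v ∈ S, I.r v := by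
  obtain ⟨s0, hs0⟩ : S.Nonempty := Finset.card_pos.1 (by omega)
  have hlt : lt (I.con S s0) I := by
    left
    have h3 : #(insert s0 (I.U \ S)) ≤ #(I.U \ S) + 1 := Finset.card_insert_le _ _
    have h4 := Finset.card_sdiff_add_card_eq_card hS
    simp only [con]; omega
  obtain ⟨o, ho⟩ := IH _ _ hlt (inst_con hI hs0 hS h2)
  refine ⟨o, fun v hv hvS => ?_, ?_⟩
  · have := ho v (by simp [con, hv, hvS])
    simp only [tl_con] at this
    have hvs : v ≠ s0 := by rintro rfl; exact hvS hs0
    have e1 : ∀ e, cf S s0 (tl I.ends o e) = v ↔ tl I.ends o e = v := by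
      intro e; unfold cf; split_ifs with h
      · constructor
        · intro h; exact absurd h.symm hvs
        · rintro rfl; exact absurd h hvS
      · rfl
    simp only [e1] at this
    simpa [con, cs, hvs] using this
  · have := ho s0 (by simp [con])
    simp only [tl_con] at this
    have e1 : ∀ e, cf S s0 (tl I.ends o e) = s0 ↔ tl I.ends o e ∈ S := by
      intro e; unfold cf; split_ifs with h
      · simp [h]
      · simp only [h, iff_false]
        intro h'; rw [h'] at h; exact h hs0
    simp only [e1] at this
    simpa [con, cs] using this
end
end OD

namespace OD
section
variable [DecidableEq V] [DecidableEq E]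

theorem X_add_Y (I : OD V E) (S : Finset V) :
    I.X S + I.Y S = ∑ v ∈ S, I.a v + ∑ v ∈ S, I.b v +
      ∑ e ∈ I.F, if ((I.ends e).1 ∈ S ∧ (I.ends e).2 ∉ S) ∨ ((I.ends e).1 ∉ S ∧ (I.ends e).2 ∈ S)
        then 1 else 0 := by
  have : (∑ e ∈ I.F, if (I.ends e).1 ∈ S ∨ (I.ends e).2 ∈ S then (1:ℤ) else 0) =
      (∑ e ∈ I.F, if (I.ends e).1 ∈ S ∧ (I.ends e).2 ∈ S then 1 else 0) + 
      ∑ e ∈ I.F, if ((I.ends e).1 ∈ S ∧ (I.ends e).2 ∉ S) ∨ ((I.ends e).1 ∉ S ∧ (I.ends e).2 ∈ S)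
        then 1 else 0 := by
    rw [← Finset.sum_add_distrib]
    refine Finset.sum_congr rfl fun e _ => ?_
    by_cases h1 : (I.ends e).1 ∈ S <;> by_cases h2 : (I.ends e).2 ∈ S <;> simp [h1, h2]
  simp only [X, Y, Finset.sum_add_distrib, Finset.sum_sub_distrib, this]
  ring

def hd (ends : E → V × V) (o : E → Bool) (e : E) : V :=
  if o e = true then (ends e).2 else (ends e).1

def cout (I : OD V E) (S : Finset V) (o : E → Bool) (v : V) : ℤ :=
  ∑ e ∈ I.F, if tl I.ends o e = v ∧ hd I.ends o e ∉ S then 1 else 0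
def cin (I : OD V E) (S : Finset V) (o : E → Bool) (v : V) : ℤ :=
  ∑ e ∈ I.F, if hd I.ends o e = v ∧ tl I.ends o e ∉ S then 1 else 0

theorem sum_cout (I : OD V E) (S : Finset V) (o : E → Bool) (B : Finset V) :
    ∑ v ∈ B, I.cout S o v =
      ∑ e ∈ I.F, if tl I.ends o e ∈ B ∧ hd I.ends o e ∉ S then 1 else 0 := by
  unfold cout
  rw [Finset.sum_comm]
  refine Finset.sum_congr rfl fun e _ => ?_
  by_cases h : hd I.ends o e ∈ S <;> simp [h, -Finset.sum_boole]

theorem sum_cin (I : OD V E) (S : Finset V) (o : E → Bool) (B : Finset V) :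
    ∑ v ∈ B, I.cin S o v =
      ∑ e ∈ I.F, if hd I.ends o e ∈ B ∧ tl I.ends o e ∉ S then 1 else 0 := by
  unfold cin
  rw [Finset.sum_comm]
  refine Finset.sum_congr rfl fun e _ => ?_
  by_cases h : tl I.ends o e ∈ S <;> simp [h, -Finset.sum_boole]

def sb (I : OD V E) (S : Finset V) (o : E → Bool) : OD V E :=
  { ends := I.ends
    F := I.F.filter fun e => (I.ends e).1 ∈ S ∧ (I.ends e).2 ∈ S
    U := S
    r := fun v => I.r v - I.cout S o v
    a := fun v => I.a v + I.cin S o v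
    b := fun v => I.b v + I.cout S o v }

theorem X_sb (I : OD V E) {S B : Finset V} (o : E → Bool) (hB : B ⊆ S) :
    (I.sb S o).X B = I.X B := by
  have e1 : (I.sb S o).X B = ∑ v ∈ B, (I.r v - I.cout S o v + (I.b v + I.cout S o v)) -
    ∑ e ∈ I.F.filter fun e => (I.ends e).1 ∈ S ∧ (I.ends e).2 ∈ S,
      if (I.ends e).1 ∈ B ∧ (I.ends e).2 ∈ B then 1 else 0 := rfl
  rw [e1, Finset.sum_filter]
  unfold X
  congr 1
  · exact Finset.sum_congr rfl fun v _ => by ring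
  · refine Finset.sum_congr rfl fun e _ => ?_
    by_cases h : (I.ends e).1 ∈ B ∧ (I.ends e).2 ∈ B
    · simp [h, hB h.1, hB h.2]
    · simp [h]

theorem Y_sb (I : OD V E) {S B : Finset V} (o : E → Bool) (hB : B ⊆ S) :
    (I.sb S o).Y B = I.Y B := by
  have e1 : (I.sb S o).Y B = ∑ v ∈ B, (I.a v + I.cin S o v - (I.r v - I.cout S o v)) +
    ∑ e ∈ I.F.filter fun e => (I.ends e).1 ∈ S ∧ (I.ends e).2 ∈ S,
      if (I.ends e).1 ∈ B ∨ (I.ends e).2 ∈ B then 1 else 0 := rfl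
  rw [e1, Finset.sum_filter]
  unfold Y
  simp only [Finset.sum_add_distrib, Finset.sum_sub_distrib, sum_cin, sum_cout]
  have : (∑ e ∈ I.F, if (I.ends e).1 ∈ B ∨ (I.ends e).2 ∈ B then (1:ℤ) else 0) =
      (∑ e ∈ I.F, if hd I.ends o e ∈ B ∧ tl I.ends o e ∉ S then 1 else 0) +
      (∑ e ∈ I.F, if tl I.ends o e ∈ B ∧ hd I.ends o e ∉ S then 1 else 0) +
      ∑ e ∈ I.F, if (I.ends e).1 ∈ S ∧ (I.ends e).2 ∈ S then
        (if (I.ends e).1 ∈ B ∨ (I.ends e).2 ∈ B then 1 else 0) else 0 := by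
    rw [← Finset.sum_add_distrib, ← Finset.sum_add_distrib]
    refine Finset.sum_congr rfl fun e _ => ?_
    have h1 : (I.ends e).1 ∈ B → (I.ends e).1 ∈ S := fun h => hB h
    have h2 : (I.ends e).2 ∈ B → (I.ends e).2 ∈ S := fun h => hB h
    unfold hd tl
    cases o e <;> by_cases h3 : (I.ends e).1 ∈ S <;> by_cases h4 : (I.ends e).2 ∈ S <;>
      by_cases h5 : (I.ends e).1 ∈ B <;> by_cases h6 : (I.ends e).2 ∈ B <;> simp_all
  rw [this]; ring

theorem caseT {k : ℤ} {I : OD V E} {v0 : V} (hI : Inst k I v0)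
    (IH : ∀ (J : OD V E) (v1 : V), lt J I → Inst k J v1 → Sol k J) {S : Finset V}
    (hS : S ⊆ I.U) (h2 : 2 ≤ #S) (hSU : S ≠ I.U) (hG : ¬ Good k k I S) : Sol k I := by
  obtain ⟨o, ho1, ho2⟩ := exists_con hI IH hS h2
  have split : (∑ e ∈ I.F, if tl I.ends o e ∈ S then (1:ℤ) else 0) = 
      (∑ e ∈ I.F, if (I.ends e).1 ∈ S ∧ (I.ends e).2 ∈ S then 1 else 0) +
      ∑ e ∈ I.F, if tl I.ends o e ∈ S ∧ hd I.ends o e ∉ S then 1 else 0 := by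
    rw [← Finset.sum_add_distrib]
    refine Finset.sum_congr rfl fun e _ => ?_
    unfold hd tl
    cases o e <;> by_cases h3 : (I.ends e).1 ∈ S <;> by_cases h4 : (I.ends e).2 ∈ S <;> simp_all
  have cin0 : ∀ v, 0 ≤ I.cin S o v := fun v =>
    Finset.sum_nonneg fun e _ => by split_ifs <;> norm_num
  have cout0 : ∀ v, 0 ≤ I.cout S o v := fun v =>
    Finset.sum_nonneg fun e _ => by split_ifs <;> norm_num
  have cardF2 : ((#(I.F.filter fun e => (I.ends e).1 ∈ S ∧ (I.ends e).2 ∈ S) : ℕ) : ℤ) =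
      ∑ e ∈ I.F, if (I.ends e).1 ∈ S ∧ (I.ends e).2 ∈ S then 1 else 0 := by
    rw [Finset.sum_boole]
  have hlt : lt (I.sb S o) I := by
    left
    have h3 : #S < #I.U := Finset.card_lt_card (Finset.ssubset_iff_subset_ne.2 ⟨hS, hSU⟩)
    have h4 := Finset.card_filter_le I.F fun e => (I.ends e).1 ∈ S ∧ (I.ends e).2 ∈ S
    simp only [sb]; omega
  have hInst : Inst k (I.sb S o) v0 := by
    refine ⟨?_, ?_, ?_, ?_, ?_, ?_⟩
    · intro e he
      exact (Finset.mem_filter.1 he).2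
    · intro v; exact add_nonneg (hI.a0 v) (cin0 v)
    · intro v; exact add_nonneg (hI.b0 v) (cout0 v)
    · have hX := I.X_sb o (Finset.Subset.refl S)
      have hY := I.Y_sb o (Finset.Subset.refl S)
      have hD := (I.sb S o).X_add_Y S
      have z : (∑ e ∈ (I.sb S o).F, if (((I.sb S o).ends e).1 ∈ S ∧ ((I.sb S o).ends e).2 ∉ S) ∨
          (((I.sb S o).ends e).1 ∉ S ∧ ((I.sb S o).ends e).2 ∈ S) then (1:ℤ) else 0) = 0 := by
        refine Finset.sum_eq_zero fun e he => ?_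
        have := (Finset.mem_filter.1 he).2
        change (if ((I.ends e).1 ∈ S ∧ (I.ends e).2 ∉ S) ∨
          ((I.ends e).1 ∉ S ∧ (I.ends e).2 ∈ S) then (1:ℤ) else 0) = 0
        simp [this]
      rw [z, hX, hY] at hD
      obtain ⟨j, hj⟩ := ho2
      have hb : ∑ v ∈ S, (I.sb S o).b v = I.X S + j * k := by
        have e1 : ∑ v ∈ S, (I.sb S o).b v = ∑ v ∈ S, (I.b v + I.cout S o v) := rfl
        rw [e1, Finset.sum_add_distrib, sum_cout]
        unfold X
        rw [Finset.sum_add_distrib]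
        linear_combination hj - split
      have ha : ∑ v ∈ S, (I.sb S o).a v = I.Y S - j * k := by linarith
      have hb0 : 0 ≤ ∑ v ∈ S, (I.sb S o).b v :=
        Finset.sum_nonneg fun v _ => add_nonneg (hI.b0 v) (cout0 v)
      have ha0 : 0 ≤ ∑ v ∈ S, (I.sb S o).a v :=
        Finset.sum_nonneg fun v _ => add_nonneg (hI.a0 v) (cin0 v)
      change (∑ v ∈ S, (I.sb S o).a v ≤ 2 * k - 1 ∧ ∑ v ∈ S, (I.sb S o).b v ≤ k - 1) ∨
        (∑ v ∈ S, (I.sb S o).a v ≤ k - 1 ∧ ∑ v ∈ S, (I.sb S o).b v ≤ 2 * k - 1)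
      rw [ha, hb] at *
      unfold Good at hG
      push Not at hG
      have g1 := hG j
      have g2 := hG (j + 1)
      have g3 := hG (j - 1)
      have e2 : (j + 1) * k = j * k + k := by ring
      have e3 : (j - 1) * k = j * k - k := by ring
      rw [e2] at g2
      rw [e3] at g3
      generalize j * k = jk at *
      by_cases c1 : k ≤ I.X S + jk
      · have := g1 c1
        by_cases c2 : k ≤ I.X S + (jk - k)
        · have := g3 c2; omega
        · right; omega
      · have := g2 (by omega)
        left; omega
    · have : ∑ v ∈ S, (I.r v - I.cout S o v) = 
        ∑ v ∈ S, I.r v - ∑ e ∈ I.F, if tl I.ends o e ∈ S ∧ hd I.ends o e ∉ S then 1 else 0 := by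
        rw [Finset.sum_sub_distrib, sum_cout]
      change k ∣ ∑ v ∈ S, (I.r v - I.cout S o v) -
        ((#(I.F.filter fun e => (I.ends e).1 ∈ S ∧ (I.ends e).2 ∈ S) : ℕ) : ℤ)
      rw [this, cardF2]
      rw [← dvd_neg] at ho2
      refine ho2.trans (dvd_of_eq ?_)
      rw [split]; ring
    · intro B hB hne hneS
      change B ⊆ S at hB
      change B ≠ S at hneS
      have hBU : B ≠ I.U := by
        rintro rfl
        exact hneS (Finset.Subset.antisymm hB hS)
      unfold Good Exempt
      rw [X_sb I o hB, Y_sb I o hB]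
      exact hI.good B (hB.trans hS) hne hBU
  obtain ⟨o2, ho3⟩ := IH _ _ hlt hInst
  refine ⟨fun e => if (I.ends e).1 ∈ S ∧ (I.ends e).2 ∈ S then o2 e else o e, fun v hv => ?_⟩
  by_cases hvS : v ∈ S
  · have h3 : k ∣ (∑ e ∈ I.F.filter fun e => (I.ends e).1 ∈ S ∧ (I.ends e).2 ∈ S,
      if tl I.ends o2 e = v then 1 else 0) - (I.r v - I.cout S o v) := ho3 v hvS
    rw [Finset.sum_filter] at h3
    refine h3.trans (dvd_of_eq ?_)
    unfold cout
    have : ∀ p q r s : ℤ, p + r = s → p - (q - r) = s - q := fun p q r s h => by rw [← h]; ring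
    apply this
    rw [← Finset.sum_add_distrib]
    refine Finset.sum_congr rfl fun e _ => ?_
    unfold hd tl
    by_cases h : (I.ends e).1 ∈ S ∧ (I.ends e).2 ∈ S
    · obtain ⟨h4, h5⟩ := h
      cases h6 : o e <;> cases h7 : o2 e <;> simp [h4, h5, h6, h7]
    · have q1 : (I.ends e).1 = v → (I.ends e).1 ∈ S := fun h => h ▸ hvS
      have q2 : (I.ends e).2 = v → (I.ends e).2 ∈ S := fun h => h ▸ hvS
      have q3 : (I.ends e).1 = v → (I.ends e).2 ∉ S := fun h' h'' => h ⟨q1 h', h''⟩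
      have q4 : (I.ends e).2 = v → (I.ends e).1 ∉ S := fun h' h'' => h ⟨h'', q2 h'⟩
      simp only [h, if_false]
      cases h6 : o e
      · by_cases c2 : (I.ends e).2 = v
        · simp [c2, q4 c2]
        · simp [c2]
      · by_cases c2 : (I.ends e).1 = v
        · simp [c2, q3 c2]
        · simp [c2]
  · refine (ho1 v hv hvS).trans (dvd_of_eq ?_)
    congr 1
    refine Finset.sum_congr rfl fun e _ => ?_
    unfold tl
    by_cases h : (I.ends e).1 ∈ S ∧ (I.ends e).2 ∈ S
    · have q1 : (I.ends e).1 ≠ v := fun h' => hvS (h' ▸ h.1)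
      have q2 : (I.ends e).2 ≠ v := fun h' => hvS (h' ▸ h.2)
      have : ∀ p : Prop, ∀ [Decidable p], (if p then (I.ends e).1 else (I.ends e).2) ≠ v := by
        intro p _; split_ifs <;> assumption
      rw [if_neg (this _), if_neg (this _)]
    · simp only [h, if_false]
end
end OD

namespace OD
section
variable [DecidableEq V] [DecidableEq E]

theorem set_cases {S : Finset V} (h : S.Nonempty) : (∃ v, S = {v}) ∨ 2 ≤ #S := by
  have := Finset.card_pos.2 h
  by_cases h1 : #S = 1
  · exact Or.inl (Finset.card_eq_one.1 h1)
  · right; omega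

theorem good_drop {k : ℤ} {I J : OD V E} {S : Finset V} (h : Good k k I S)
    (hX : I.X S - 1 ≤ J.X S) (hY : I.Y S - 1 ≤ J.Y S) : Good k (k - 1) J S := by
  obtain ⟨m, h1, h2⟩ := h
  exact ⟨m, by linarith, by linarith⟩

theorem good_mono {k j : ℤ} {I J : OD V E} {S : Finset V} (h : Good k j I S)
    (hX : I.X S ≤ J.X S) (hY : I.Y S ≤ J.Y S) : Good k j J S := by
  obtain ⟨m, h1, h2⟩ := h
  exact ⟨m, by linarith, by linarith⟩

theorem Joins.symm {I : OD V E} {e : E} {t h : V} (hj : I.Joins e t h) : I.Joins e h t := by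
  unfold Joins at *; tauto

theorem Joins.mem {k : ℤ} {I : OD V E} {v0 : V} (hI : Inst k I v0) {e : E} (he : e ∈ I.F)
    {t h : V} (hj : I.Joins e t h) : t ∈ I.U ∧ h ∈ I.U := by
  have := hI.endsU e he
  rcases hj with hj | hj <;> rw [hj] at this
  · exact this
  · exact this.symm

structure ZC (k : ℤ) (I : OD V E) (z : V) : Prop where
  hz : z ∈ I.U
  h2 : 2 ≤ #I.U
  hT : ∀ S ⊆ I.U, 2 ≤ #S → S ≠ I.U → Good k k I S
  hex : Exempt k I {z}
  hoth : ∀ v ∈ I.U, v ≠ z → Good k (k - 1) I {v}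

theorem caseZ1 {k : ℤ} {I : OD V E} {v0 z : V} (hI : Inst k I v0)
    (IH : ∀ (J : OD V E) (v1 : V), lt J I → Inst k J v1 → Sol k J) (hZ : ZC k I z)
    (ha : 1 ≤ I.a z) {e : E} {u : V} (he : e ∈ I.F) (hj : I.Joins e z u) (hu : u ≠ z) :
    Sol k I := by
  set a' : V → ℤ := fun v => I.a v - (if v = z then 1 else 0) + (if v = u then 1 else 0) with ha'
  have hsum : ∀ S : Finset V, ∑ v ∈ S, (a' v - I.a v) =
      (if u ∈ S then 1 else 0) - (if z ∈ S then 1 else 0) := by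
    intro S
    have : ∀ v, a' v - I.a v = (if v = u then 1 else 0) - (if v = z then 1 else 0) := by
      intro v; simp only [ha']; ring
    simp only [this, Finset.sum_sub_distrib, Finset.sum_ite_eq']
  have huU : u ∈ I.U := (hj.mem hI he).2
  have hX : ∀ S, (I.od e z a' I.b).X S = I.X S - (if z ∈ S ∧ u ∉ S then 1 else 0) := by
    intro S; rw [X_od he hj]; simp
  have hY : ∀ S, (I.od e z a' I.b).Y S = I.Y S - (if u ∈ S ∧ z ∉ S then 1 else 0) +
      ((if u ∈ S then 1 else 0) - (if z ∈ S then 1 else 0)) := by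
    intro S; rw [Y_od he hj, hsum]
  refine sol_od he hj (IH _ z (lt_od he) (inst_od (a' := a') (b' := I.b) hI he hj ?_ hI.b0 ?_ ?_))
  · intro v
    have := hI.a0 v
    simp only [ha']
    by_cases hv : v = z
    · subst hv; simp [hu.symm]; omega
    · simp only [hv, if_false]; split_ifs <;> omega
  · have := hsum I.U
    rw [Finset.sum_sub_distrib] at this
    simp only [huU, hZ.hz, if_true] at this
    have : ∑ v ∈ I.U, a' v = ∑ v ∈ I.U, I.a v := by linarith
    rw [this]; exact hI.root
  · intro S hS hne hneU
    rcases set_cases hne with ⟨v, rfl⟩ | h2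
    · by_cases hv : v = z
      · subst hv
        right
        refine ⟨rfl, ?_⟩
        obtain ⟨m, hm⟩ := hZ.hex
        refine ⟨m, ?_⟩
        rw [hX, hY]; simp [hu]; linarith
      · left
        refine good_mono (hZ.hoth v (hS (by simp)) hv) ?_ ?_
        · rw [hX]; simp [Ne.symm hv]
        · rw [hY]; by_cases hvu : u = v <;> simp [Ne.symm hv, hvu]
    · left
      refine good_drop (hZ.hT S hS h2 hneU) ?_ ?_
      · rw [hX]; split_ifs <;> omega
      · rw [hY]; by_cases h3 : u ∈ S <;> by_cases h4 : z ∈ S <;> simp [h3, h4]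

theorem ZC.mirror {k : ℤ} {I : OD V E} {z : V} (h : ZC k I z) : ZC k I.mirror z where
  hz := h.hz
  h2 := h.h2
  hT := fun S h1 h2 h3 => good_mirror (h.hT S h1 h2 h3)
  hex := exempt_mirror h.hex
  hoth := fun v h1 h2 => good_mirror (h.hoth v h1 h2)

theorem IH_mirror {k : ℤ} {I : OD V E}
    (IH : ∀ (J : OD V E) (v1 : V), lt J I → Inst k J v1 → Sol k J) :
    ∀ (J : OD V E) (v1 : V), lt J I.mirror → Inst k J v1 → Sol k J :=
  fun J v1 h1 h2 => IH J v1 (lt_mirror h1) h2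

theorem caseZ2 {k : ℤ} {I : OD V E} {v0 z : V} (hI : Inst k I v0)
    (IH : ∀ (J : OD V E) (v1 : V), lt J I → Inst k J v1 → Sol k J) (hZ : ZC k I z)
    (hb : 1 ≤ I.b z) {e : E} {u : V} (he : e ∈ I.F) (hj : I.Joins e z u) (hu : u ≠ z) :
    Sol k I :=
  sol_mirror (caseZ1 (inst_mirror hI) (IH_mirror IH) hZ.mirror (z := z) hb (e := e) (u := u)
    he hj hu)

/-! lifting -/

def lf (I : OD V E) (e1 e2 : E) (z u w : V) : OD V E :=
  { I with
    ends := Function.update I.ends e1 (u, w)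
    F := I.F.erase e2
    r := fun v => I.r v - if v = z then 1 else 0 }

theorem sum_lf {I : OD V E} {e1 e2 : E} (he1 : e1 ∈ I.F) (he2 : e2 ∈ I.F) (hne : e1 ≠ e2)
    (p : V × V) (f : V × V → ℤ) :
    ∑ e ∈ I.F.erase e2, f (Function.update I.ends e1 p e) =
      ∑ e ∈ I.F, f (I.ends e) - f (I.ends e1) - f (I.ends e2) + f p := by
  rw [← Finset.add_sum_erase _ _ he2]
  have h1 : e1 ∈ I.F.erase e2 := Finset.mem_erase.2 ⟨hne, he1⟩
  rw [← Finset.add_sum_erase _ (fun e => f (Function.update I.ends e1 p e)) h1,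
    ← Finset.add_sum_erase _ (fun e => f (I.ends e)) h1]
  have : ∑ e ∈ (I.F.erase e2).erase e1, f (Function.update I.ends e1 p e) =
      ∑ e ∈ (I.F.erase e2).erase e1, f (I.ends e) := by
    refine Finset.sum_congr rfl fun e he => ?_
    rw [Function.update_of_ne (Finset.ne_of_mem_erase he)]
  rw [this, Function.update_self]
  ring

theorem X_lf {I : OD V E} {e1 e2 : E} (he1 : e1 ∈ I.F) (he2 : e2 ∈ I.F) (hne : e1 ≠ e2)
    {z u w : V} (hj1 : I.Joins e1 z u) (hj2 : I.Joins e2 z w) (S : Finset V) :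
    (I.lf e1 e2 z u w).X S = I.X S -
      (if (z ∈ S ∧ u ∉ S ∧ w ∉ S) ∨ (z ∉ S ∧ u ∈ S ∧ w ∈ S) then 1 else 0) := by
  have e0 : (I.lf e1 e2 z u w).X S = ∑ v ∈ S, (I.r v - (if v = z then 1 else 0) + I.b v) -
    ∑ e ∈ I.F.erase e2, if (Function.update I.ends e1 (u, w) e).1 ∈ S ∧
      (Function.update I.ends e1 (u, w) e).2 ∈ S then 1 else 0 := rfl
  rw [e0, sum_lf he1 he2 hne (u, w) (fun p => if p.1 ∈ S ∧ p.2 ∈ S then 1 else 0)]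
  simp only [X, Finset.sum_add_distrib, Finset.sum_sub_distrib, Finset.sum_ite_eq']
  rcases hj1 with hj1 | hj1 <;> rcases hj2 with hj2 | hj2 <;> rw [hj1, hj2] <;>
  by_cases h1 : z ∈ S <;> by_cases h2 : u ∈ S <;> by_cases h3 : w ∈ S <;>
    simp [h1, h2, h3, -Finset.sum_boole] <;> ring

theorem Y_lf {I : OD V E} {e1 e2 : E} (he1 : e1 ∈ I.F) (he2 : e2 ∈ I.F) (hne : e1 ≠ e2)
    {z u w : V} (hj1 : I.Joins e1 z u) (hj2 : I.Joins e2 z w) (S : Finset V) :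
    (I.lf e1 e2 z u w).Y S = I.Y S -
      (if (z ∈ S ∧ u ∉ S ∧ w ∉ S) ∨ (z ∉ S ∧ u ∈ S ∧ w ∈ S) then 1 else 0) := by
  have e0 : (I.lf e1 e2 z u w).Y S = ∑ v ∈ S, (I.a v - (I.r v - (if v = z then 1 else 0))) +
    ∑ e ∈ I.F.erase e2, if (Function.update I.ends e1 (u, w) e).1 ∈ S ∨
      (Function.update I.ends e1 (u, w) e).2 ∈ S then 1 else 0 := rfl
  rw [e0, sum_lf he1 he2 hne (u, w) (fun p => if p.1 ∈ S ∨ p.2 ∈ S then 1 else 0)]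
  simp only [Y, Finset.sum_sub_distrib, Finset.sum_ite_eq']
  rcases hj1 with hj1 | hj1 <;> rcases hj2 with hj2 | hj2 <;> rw [hj1, hj2] <;>
  by_cases h1 : z ∈ S <;> by_cases h2 : u ∈ S <;> by_cases h3 : w ∈ S <;>
    simp [h1, h2, h3, -Finset.sum_boole] <;> ring

theorem Joins.bit {I : OD V E} {e : E} {t h : V} (hj : I.Joins e t h) :
    ∃ bt : Bool, (if bt = true then (I.ends e).1 else (I.ends e).2) = t := by
  rcases hj with hj | hj
  · exact ⟨true, by simp [hj]⟩
  · exact ⟨false, by simp [hj]⟩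

theorem sol_lf {k : ℤ} {I : OD V E} {e1 e2 : E} (he1 : e1 ∈ I.F) (he2 : e2 ∈ I.F) (hne : e1 ≠ e2)
    {z u w : V} (hj1 : I.Joins e1 z u) (hj2 : I.Joins e2 z w)
    (hs : Sol k (I.lf e1 e2 z u w)) : Sol k I := by
  obtain ⟨o, ho⟩ := hs
  obtain ⟨b1, b2, hb⟩ : ∃ b1 b2 : Bool, ∀ v,
      ((if (if b1 = true then (I.ends e1).1 else (I.ends e1).2) = v then (1:ℤ) else 0) +
      if (if b2 = true then (I.ends e2).1 else (I.ends e2).2) = v then (1:ℤ) else 0) =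
      (if v = z then 1 else 0) + if (if o e1 = true then u else w) = v then (1:ℤ) else 0 := by
    cases h : o e1
    · obtain ⟨b1, hb1⟩ := hj1.bit
      obtain ⟨b2, hb2⟩ := hj2.symm.bit
      refine ⟨b1, b2, fun v => ?_⟩
      rw [hb1, hb2]; simp [eq_comm (a := v) (b := z)]
    · obtain ⟨b1, hb1⟩ := hj1.symm.bit
      obtain ⟨b2, hb2⟩ := hj2.bit
      refine ⟨b1, b2, fun v => ?_⟩
      rw [hb1, hb2, add_comm]; simp [eq_comm (a := v) (b := z)]
  refine ⟨Function.update (Function.update o e1 b1) e2 b2, fun v hv => ?_⟩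
  have h1 : k ∣ (∑ x ∈ I.F.erase e2, if tl (Function.update I.ends e1 (u, w)) o x = v then 1 else 0) -
    (I.r v - if v = z then 1 else 0) := ho v hv
  refine h1.trans (dvd_of_eq ?_)
  have m1 : e1 ∈ I.F.erase e2 := Finset.mem_erase.2 ⟨hne, he1⟩
  rw [← Finset.add_sum_erase _ _ he2, ← Finset.add_sum_erase _ _ m1, ← Finset.add_sum_erase _ _ m1]
  have q : ∑ x ∈ (I.F.erase e2).erase e1,
      (if tl (Function.update I.ends e1 (u, w)) o x = v then (1:ℤ) else 0) =
      ∑ x ∈ (I.F.erase e2).erase e1,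
      (if tl I.ends (Function.update (Function.update o e1 b1) e2 b2) x = v then (1:ℤ) else 0) := by
    refine Finset.sum_congr rfl fun x hx => ?_
    have hx1 := Finset.ne_of_mem_erase hx
    have hx2 := Finset.ne_of_mem_erase (Finset.mem_of_mem_erase hx)
    unfold tl
    rw [Function.update_of_ne hx1, Function.update_of_ne hx2, Function.update_of_ne hx1]
  have t1 : tl I.ends (Function.update (Function.update o e1 b1) e2 b2) e1 =
      if b1 = true then (I.ends e1).1 else (I.ends e1).2 := by
    unfold tl; rw [Function.update_of_ne hne, Function.update_self]
  have t2 : tl I.ends (Function.update (Function.update o e1 b1) e2 b2) e2 =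
      if b2 = true then (I.ends e2).1 else (I.ends e2).2 := by
    unfold tl; rw [Function.update_self]
  have t3 : tl (Function.update I.ends e1 (u, w)) o e1 = if o e1 = true then u else w := by
    unfold tl; rw [Function.update_self]
  rw [q, t1, t2, t3]
  linear_combination -(hb v)

theorem caseZ4 {k : ℤ} {I : OD V E} {v0 z : V} (hI : Inst k I v0)
    (IH : ∀ (J : OD V E) (v1 : V), lt J I → Inst k J v1 → Sol k J) (hZ : ZC k I z)
    {e1 e2 : E} {u w : V} (he1 : e1 ∈ I.F) (he2 : e2 ∈ I.F) (hj1 : I.Joins e1 z u)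
    (hj2 : I.Joins e2 z w) (hu : u ≠ z) (hw : w ≠ z) (huw : u ≠ w) : Sol k I := by
  have hne : e1 ≠ e2 := by
    rintro rfl
    unfold Joins at hj1 hj2
    rcases hj1 with h | h <;> rcases hj2 with h' | h' <;> rw [h] at h' <;>
      simp only [Prod.mk.injEq] at h' <;> tauto
  have huU := (hj1.mem hI he1).2
  have hwU := (hj2.mem hI he2).2
  refine sol_lf he1 he2 hne hj1 hj2 (IH _ z ?_ ?_)
  · left
    have := Finset.card_erase_lt_of_mem he2
    simp only [lf]; omega
  · refine ⟨?_, hI.a0, hI.b0, hI.root, ?_, ?_⟩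
    · intro e he
      change (Function.update I.ends e1 (u, w) e).1 ∈ I.U ∧ (Function.update I.ends e1 (u, w) e).2 ∈ I.U
      by_cases h : e = e1
      · subst h; rw [Function.update_self]; exact ⟨huU, hwU⟩
      · rw [Function.update_of_ne h]
        exact hI.endsU e (Finset.mem_of_mem_erase he)
    · have h1 := hI.cong
      simp only [lf, Finset.sum_sub_distrib, Finset.sum_ite_eq', hZ.hz, if_true]
      rw [Finset.card_erase_of_mem he2, Nat.cast_sub (Finset.card_pos.2 ⟨e2, he2⟩)]
      refine h1.trans (dvd_of_eq ?_)
      push_cast; ring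
    · intro S hS hn hnU
      change S ⊆ I.U at hS
      change S ≠ I.U at hnU
      rcases set_cases hn with ⟨v, rfl⟩ | h2
      · by_cases hv : v = z
        · subst hv
          right
          refine ⟨rfl, ?_⟩
          obtain ⟨m, hm⟩ := hZ.hex
          refine ⟨m, ?_⟩
          rw [X_lf he1 he2 hne hj1 hj2, Y_lf he1 he2 hne hj1 hj2]; linarith
        · left
          have : ¬ ((z ∈ ({v} : Finset V) ∧ u ∉ ({v} : Finset V) ∧ w ∉ ({v} : Finset V)) ∨
            (z ∉ ({v} : Finset V) ∧ u ∈ ({v} : Finset V) ∧ w ∈ ({v} : Finset V))) := by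
            simp only [Finset.mem_singleton]
            rintro (h | h)
            · exact hv h.1.symm
            · exact huw (h.2.1.trans h.2.2.symm)
          refine good_mono (hZ.hoth v (hS (by simp)) hv) ?_ ?_
          · rw [X_lf he1 he2 hne hj1 hj2, if_neg this]; simp
          · rw [Y_lf he1 he2 hne hj1 hj2, if_neg this]; simp
      · left
        refine good_drop (hZ.hT S hS h2 hnU) ?_ ?_
        · rw [X_lf he1 he2 hne hj1 hj2]; split_ifs <;> omega
        · rw [Y_lf he1 he2 hne hj1 hj2]; split_ifs <;> omega

end
end OD

namespace OD
section
variable [DecidableEq V] [DecidableEq E]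

theorem X_U {k : ℤ} {I : OD V E} {v0 : V} (hI : Inst k I v0) :
    I.X I.U = ∑ v ∈ I.U, I.r v + ∑ v ∈ I.U, I.b v - #I.F := by
  unfold X
  rw [Finset.sum_add_distrib, Finset.sum_congr rfl (s₁ := I.F) (g := fun _ => (1:ℤ))]
  · simp
  · intro e he; simp [hI.endsU e he]

theorem Y_U {k : ℤ} {I : OD V E} {v0 : V} (hI : Inst k I v0) :
    I.Y I.U = ∑ v ∈ I.U, I.a v - ∑ v ∈ I.U, I.r v + #I.F := by
  unfold Y
  rw [Finset.sum_sub_distrib, Finset.sum_congr rfl (s₁ := I.F) (g := fun _ => (1:ℤ))]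
  · simp
  · intro e he; simp [hI.endsU e he]

theorem caseZ5a {k : ℤ} (hk : 2 ≤ k) {I : OD V E} {v0 z : V} (hI : Inst k I v0) (hZ : ZC k I z)
    (hl : ∀ e ∈ I.F, ∀ u, I.Joins e z u → u = z) (hab : 1 ≤ I.a z + I.b z) : False := by
  have hiff : ∀ e ∈ I.F, ((I.ends e).1 = z ↔ (I.ends e).2 = z) := by
    intro e he
    constructor
    · intro h; exact hl e he _ (Or.inl (by rw [← h]))
    · intro h; exact hl e he _ (Or.inr (by rw [← h]))
  have hXs : I.X I.U = I.X {z} + I.X (I.U.erase z) := by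
    have e1 := Finset.add_sum_erase I.U (fun v => I.r v + I.b v) hZ.hz
    have e2 : (∑ e ∈ I.F, if (I.ends e).1 ∈ I.U ∧ (I.ends e).2 ∈ I.U then (1:ℤ) else 0) =
      (∑ e ∈ I.F, if (I.ends e).1 ∈ ({z} : Finset V) ∧ (I.ends e).2 ∈ ({z} : Finset V) then 1 else 0) +
      (∑ e ∈ I.F, if (I.ends e).1 ∈ I.U.erase z ∧ (I.ends e).2 ∈ I.U.erase z then 1 else 0) := by
      rw [← Finset.sum_add_distrib]
      refine Finset.sum_congr rfl fun e he => ?_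
      have h1 := hI.endsU e he
      have h2 := hiff e he
      by_cases h : (I.ends e).1 = z
      · simp [h, h2.1 h, hZ.hz]
      · have h' : (I.ends e).2 ≠ z := fun h' => h (h2.2 h')
        simp [h, h', h1]
    unfold X
    rw [e2, ← e1, Finset.sum_singleton]; ring
  have hYs : I.Y I.U = I.Y {z} + I.Y (I.U.erase z) := by
    have e1 := Finset.add_sum_erase I.U (fun v => I.a v - I.r v) hZ.hz
    have e2 : (∑ e ∈ I.F, if (I.ends e).1 ∈ I.U ∨ (I.ends e).2 ∈ I.U then (1:ℤ) else 0) =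
      (∑ e ∈ I.F, if (I.ends e).1 ∈ ({z} : Finset V) ∨ (I.ends e).2 ∈ ({z} : Finset V) then 1 else 0) +
      (∑ e ∈ I.F, if (I.ends e).1 ∈ I.U.erase z ∨ (I.ends e).2 ∈ I.U.erase z then 1 else 0) := by
      rw [← Finset.sum_add_distrib]
      refine Finset.sum_congr rfl fun e he => ?_
      have h1 := hI.endsU e he
      have h2 := hiff e he
      by_cases h : (I.ends e).1 = z
      · simp [h, h2.1 h, hZ.hz]
      · have h' : (I.ends e).2 ≠ z := fun h' => h (h2.2 h')
        simp [h, h', h1]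
    unfold Y
    rw [e2, ← e1, Finset.sum_singleton]; ring
  have hD := I.X_add_Y {z}
  have hc : 0 ≤ ∑ e ∈ I.F, if ((I.ends e).1 ∈ ({z} : Finset V) ∧ (I.ends e).2 ∉ ({z} : Finset V)) ∨
      ((I.ends e).1 ∉ ({z} : Finset V) ∧ (I.ends e).2 ∈ ({z} : Finset V)) then (1:ℤ) else 0 :=
    Finset.sum_nonneg fun e _ => by split_ifs <;> norm_num
  rw [Finset.sum_singleton, Finset.sum_singleton] at hD
  have hcard := Finset.card_erase_add_one hZ.hz
  have h2 := hZ.h2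
  have hG : Good k (k - 1) I (I.U.erase z) := by
    have hne : (I.U.erase z).Nonempty := Finset.card_pos.1 (by omega)
    have hneU : I.U.erase z ≠ I.U := by
      intro h; rw [h] at hcard; omega
    rcases set_cases hne with ⟨v, hv⟩ | h2
    · have hm : v ∈ I.U.erase z := by rw [hv]; simp
      rw [hv]
      exact hZ.hoth v (Finset.mem_of_mem_erase hm) (Finset.ne_of_mem_erase hm)
    · obtain ⟨m, h3, h4⟩ := hZ.hT _ (Finset.erase_subset _ _) h2 hneU
      exact ⟨m, by omega, by omega⟩
  obtain ⟨m, hm⟩ := hZ.hex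
  obtain ⟨j, hj1, hj2⟩ := hG
  obtain ⟨c, hc'⟩ := hI.cong
  have hXU := X_U hI
  have hYU := Y_U hI
  have p1 : k - 1 ≤ ∑ v ∈ I.U, I.b v - (I.X {z} + m * k) + (c + m + j) * k := by linarith
  have p2 : k - 1 ≤ ∑ v ∈ I.U, I.a v - (I.X {z} + m * k) - (c + m + j) * k := by linarith
  have p3 : 0 < I.X {z} + m * k := by linarith
  generalize I.X {z} + m * k = s at *
  generalize c + m + j = n at *
  rcases hI.root with ⟨r1, r2⟩ | ⟨r1, r2⟩
  · have : 0 < n * k := by linarith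
    have : 0 < n := by by_contra h; nlinarith
    nlinarith
  · have : n * k < 0 := by linarith
    have : n < 0 := by by_contra h; nlinarith
    nlinarith

theorem caseZ5b {k : ℤ} {I : OD V E} {v0 z u : V} (hI : Inst k I v0)
    (IH : ∀ (J : OD V E) (v1 : V), lt J I → Inst k J v1 → Sol k J) (hZ : ZC k I z)
    (ha : I.a z = 0) (hb : I.b z = 0) (hu : u ∈ I.U) (huz : u ≠ z)
    (hall : ∀ e ∈ I.F, ∀ x, I.Joins e z x → x = z ∨ x = u) : Sol k I := by
  have hzu : z ≠ u := huz.symm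
  have hSU : ({z, u} : Finset V) ⊆ I.U := by
    intro x hx; simp only [Finset.mem_insert, Finset.mem_singleton] at hx
    rcases hx with rfl | rfl
    exacts [hZ.hz, hu]
  obtain ⟨o, ho1, ho2⟩ := exists_con hI IH hSU (by rw [Finset.card_pair hzu])
  set N := I.F.filter (fun e => I.ends e = (z, u) ∨ I.ends e = (u, z)) with hN
  have hD := I.X_add_Y {z}
  rw [Finset.sum_singleton, Finset.sum_singleton, ha, hb] at hD
  have hfac : ∀ e ∈ I.F, ((I.ends e).1 = z → (I.ends e).2 = z ∨ (I.ends e).2 = u) ∧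
      ((I.ends e).2 = z → (I.ends e).1 = z ∨ (I.ends e).1 = u) := fun e he =>
    ⟨fun h => hall e he _ (Or.inl (by rw [← h])), fun h => hall e he _ (Or.inr (by rw [← h]))⟩
  have hcut : (∑ e ∈ I.F, if ((I.ends e).1 ∈ ({z} : Finset V) ∧ (I.ends e).2 ∉ ({z} : Finset V)) ∨
      ((I.ends e).1 ∉ ({z} : Finset V) ∧ (I.ends e).2 ∈ ({z} : Finset V)) then (1:ℤ) else 0) = #N := by
    rw [hN, ← Finset.sum_boole]
    refine Finset.sum_congr rfl fun e he => ?_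
    have := hfac e he
    congr 1
    rw [Prod.ext_iff, Prod.ext_iff]
    simp only [Finset.mem_singleton, eq_iff_iff]
    constructor
    · rintro (⟨h1, h2⟩ | ⟨h1, h2⟩)
      · left; exact ⟨h1, (this.1 h1).resolve_left h2⟩
      · right; exact ⟨(this.2 h2).resolve_left h1, h2⟩
    · rintro (⟨h1, h2⟩ | ⟨h1, h2⟩)
      · left; exact ⟨h1, by rw [h2]; exact huz⟩
      · right; exact ⟨by rw [h1]; exact huz, h2⟩
  rw [hcut] at hD
  obtain ⟨m, hm⟩ := hZ.hex
  have hs2 : 2 * (I.X {z} + m * k) = #N := by linarith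
  have hs0 : 0 ≤ I.X {z} + m * k := by linarith [Int.natCast_nonneg (#N)]
  obtain ⟨H, hHN, hHc⟩ := Finset.exists_subset_card_eq (s := N) (n := (I.X {z} + m * k).toNat)
    (by omega)
  have hHc' : (#H : ℤ) = I.X {z} + m * k := by rw [hHc]; exact Int.toNat_of_nonneg hs0
  set o' : E → Bool := fun e => if e ∈ N then decide ((I.ends e).1 = if e ∈ H then z else u) else o e
    with ho'
  have tN : ∀ e ∈ N, tl I.ends o' e = if e ∈ H then z else u := by
    intro e he
    have := (Finset.mem_filter.1 he).2
    unfold tl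
    simp only [ho', he, if_true]
    by_cases hH : e ∈ H <;> rcases this with h | h <;> simp [h, hH, huz, hzu]
  have tN' : ∀ e ∈ N, tl I.ends o e = z ∨ tl I.ends o e = u := by
    intro e he
    have := (Finset.mem_filter.1 he).2
    unfold tl
    rcases this with h | h <;> rw [h] <;> split_ifs <;> simp
  have tnN : ∀ e, e ∉ N → tl I.ends o' e = tl I.ends o e := by
    intro e he
    unfold tl
    simp only [ho', he, if_false]
  have outz : (∑ e ∈ I.F, if tl I.ends o' e = z then (1:ℤ) else 0) =
      (∑ e ∈ I.F, if (I.ends e).1 ∈ ({z} : Finset V) ∧ (I.ends e).2 ∈ ({z} : Finset V) then 1 else 0)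
        + #H := by
    have : (#H : ℤ) = ∑ e ∈ I.F, if e ∈ H then 1 else 0 := by
      rw [Finset.sum_boole]
      congr 2
      ext e
      simp only [Finset.mem_filter]
      exact ⟨fun h => ⟨(Finset.mem_filter.1 (hHN h)).1, h⟩, fun h => h.2⟩
    rw [this, ← Finset.sum_add_distrib]
    refine Finset.sum_congr rfl fun e he => ?_
    by_cases heN : e ∈ N
    · rw [tN e heN]
      have := (Finset.mem_filter.1 heN).2
      have : ¬ ((I.ends e).1 ∈ ({z} : Finset V) ∧ (I.ends e).2 ∈ ({z} : Finset V)) := by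
        rcases this with h | h <;> simp [h, huz]
      rw [if_neg this]
      by_cases hH : e ∈ H <;> simp [hH, huz]
    · have hH : e ∉ H := fun h => heN (hHN h)
      rw [tnN e heN, if_neg hH, add_zero]
      congr 1
      simp only [Finset.mem_singleton, eq_iff_iff]
      have hf := hfac e he
      have hnN : ¬ (I.ends e = (z, u) ∨ I.ends e = (u, z)) := fun h =>
        heN (Finset.mem_filter.2 ⟨he, h⟩)
      rw [Prod.ext_iff, Prod.ext_iff] at hnN
      simp only at hnN
      unfold tl
      split_ifs <;> tauto
  have houtz : (∑ e ∈ I.F, if tl I.ends o' e = z then (1:ℤ) else 0) - I.r z = k * m := by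
    rw [outz, hHc']
    unfold X
    rw [Finset.sum_singleton, hb]; ring
  have htot : (∑ e ∈ I.F, if tl I.ends o e ∈ ({z, u} : Finset V) then (1:ℤ) else 0) =
      (∑ e ∈ I.F, if tl I.ends o' e = z then (1:ℤ) else 0) +
      (∑ e ∈ I.F, if tl I.ends o' e = u then (1:ℤ) else 0) := by
    rw [← Finset.sum_add_distrib]
    refine Finset.sum_congr rfl fun e he => ?_
    by_cases heN : e ∈ N
    · have : tl I.ends o e ∈ ({z, u} : Finset V) := by simpa using tN' e heN
      rw [tN e heN, if_pos this]
      by_cases hH : e ∈ H <;> simp [hH, huz, hzu]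
    · rw [tnN e heN]
      by_cases h1 : tl I.ends o e = z
      · simp [h1, hzu]
      · simp [h1]
  refine ⟨o', fun v hv => ?_⟩
  by_cases hvz : v = z
  · subst hvz
    rw [houtz]; exact dvd_mul_right _ _
  by_cases hvu : v = u
  · subst hvu
    rw [htot, Finset.sum_pair hzu] at ho2
    have := dvd_sub ho2 (Dvd.intro m rfl)
    refine this.trans (dvd_of_eq ?_)
    rw [← houtz]; ring
  · refine (ho1 v hv (by simp [hvz, hvu])).trans (dvd_of_eq ?_)
    congr 1
    refine Finset.sum_congr rfl fun e he => ?_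
    by_cases heN : e ∈ N
    · have h1 : tl I.ends o e ≠ v := by
        rcases tN' e heN with h | h <;> rw [h]
        exacts [Ne.symm hvz, Ne.symm hvu]
      have h2 : tl I.ends o' e ≠ v := by
        rw [tN e heN]; split_ifs
        exacts [Ne.symm hvz, Ne.symm hvu]
      rw [if_neg h1, if_neg h2]
    · rw [tnN e heN]

theorem caseZ {k : ℤ} (hk : 2 ≤ k) {I : OD V E} {v0 z : V} (hI : Inst k I v0)
    (IH : ∀ (J : OD V E) (v1 : V), lt J I → Inst k J v1 → Sol k J) (hZ : ZC k I z) : Sol k I := by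
  by_cases hl : ∃ e ∈ I.F, ∃ u, I.Joins e z u ∧ u ≠ z
  · obtain ⟨e, he, u, hj, hu⟩ := hl
    by_cases ha : 1 ≤ I.a z
    · exact caseZ1 hI IH hZ ha he hj hu
    by_cases hb : 1 ≤ I.b z
    · exact caseZ2 hI IH hZ hb he hj hu
    by_cases h4 : ∃ e2 ∈ I.F, ∃ w, I.Joins e2 z w ∧ w ≠ z ∧ u ≠ w
    · obtain ⟨e2, he2, w, hj2, hw, huw⟩ := h4
      exact caseZ4 hI IH hZ he he2 hj hj2 hu hw huw
    · push Not at h4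
      refine caseZ5b hI IH hZ (le_antisymm (by omega) (hI.a0 z)) (le_antisymm (by omega) (hI.b0 z))
        (hj.mem hI he).2 hu ?_
      intro e2 he2 x hx
      by_cases hxz : x = z
      · exact Or.inl hxz
      · exact Or.inr (h4 e2 he2 x hx hxz).symm
  · push Not at hl
    by_cases hab : 1 ≤ I.a z + I.b z
    · exact (caseZ5a hk hI hZ hl hab).elim
    · have ha := hI.a0 z
      have hb := hI.b0 z
      obtain ⟨u, hu, huz⟩ := Finset.exists_mem_ne (s := I.U) (by have := hZ.h2; omega) z
      exact caseZ5b hI IH hZ (by omega) (by omega) hu huz fun e he x hx => Or.inl (hl e he x hx)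
end
end OD

namespace OD
section
variable [DecidableEq V] [DecidableEq E]

def Outb (k : ℤ) (I : OD V E) (v : V) : Prop :=
  ∃ m : ℤ, k ≤ I.X {v} + m * k ∧ k - 1 ≤ I.Y {v} - m * k
def Inb (k : ℤ) (I : OD V E) (v : V) : Prop :=
  ∃ m : ℤ, k - 1 ≤ I.X {v} + m * k ∧ k ≤ I.Y {v} - m * k

theorem Inb.mirror {k : ℤ} {I : OD V E} {v : V} (h : Inb k I v) : Outb k I.mirror v := by
  obtain ⟨m, h1, h2⟩ := h
  refine ⟨-m, ?_, ?_⟩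
  · rw [X_mirror]; linarith
  · rw [Y_mirror]; linarith

theorem Outb.mirror {k : ℤ} {I : OD V E} {v : V} (h : Outb k I v) : Inb k I.mirror v := by
  obtain ⟨m, h1, h2⟩ := h
  refine ⟨-m, ?_, ?_⟩
  · rw [X_mirror]; linarith
  · rw [Y_mirror]; linarith

theorem Outb.good {k : ℤ} {I : OD V E} {v : V} (h : Outb k I v) : Good k (k - 1) I {v} := by
  obtain ⟨m, h1, h2⟩ := h
  exact ⟨m, by omega, h2⟩

theorem Inb.good {k : ℤ} {I : OD V E} {v : V} (h : Inb k I v) : Good k (k - 1) I {v} := by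
  obtain ⟨m, h1, h2⟩ := h
  exact ⟨m, h1, by omega⟩

structure PC (k : ℤ) (I : OD V E) : Prop where
  h2 : 2 ≤ #I.U
  hT : ∀ S ⊆ I.U, 2 ≤ #S → S ≠ I.U → Good k k I S
  hv : ∀ v ∈ I.U, Outb k I v ∨ Inb k I v

theorem PC.mirror {k : ℤ} {I : OD V E} (h : PC k I) : PC k I.mirror where
  h2 := h.h2
  hT := fun S h1 h2 h3 => good_mirror (h.hT S h1 h2 h3)
  hv := fun v hv => (h.hv v hv).elim (fun h => Or.inr h.mirror) (fun h => Or.inl h.mirror)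

theorem PC.single {k : ℤ} {I : OD V E} (h : PC k I) {v : V} (hv : v ∈ I.U) :
    Good k (k - 1) I {v} := (h.hv v hv).elim Outb.good Inb.good

theorem PC.good {k : ℤ} {I : OD V E} (h : PC k I) {S : Finset V} (hS : S ⊆ I.U)
    (hne : S.Nonempty) (hneU : S ≠ I.U) : Good k (k - 1) I S := by
  rcases set_cases hne with ⟨v, rfl⟩ | h2
  · exact h.single (hS (by simp))
  · exact good_drop (h.hT S hS h2 hneU) (by omega) (by omega)

theorem caseP1 {k : ℤ} {I : OD V E} {v0 v : V} (hI : Inst k I v0)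
    (IH : ∀ (J : OD V E) (v1 : V), lt J I → Inst k J v1 → Sol k J) (hP : PC k I)
    (hv : v ∈ I.U) (hb : 1 ≤ I.b v) (ho : Outb k I v) : Sol k I := by
  set b' : V → ℤ := fun x => I.b x - if x = v then 1 else 0 with hb'
  have hsum : ∀ S : Finset V, ∑ x ∈ S, b' x = ∑ x ∈ S, I.b x - if v ∈ S then 1 else 0 := by
    intro S
    simp only [hb', Finset.sum_sub_distrib, Finset.sum_ite_eq']
  set J : OD V E := { I with b := b' } with hJ
  have hX : ∀ S, J.X S = I.X S - if v ∈ S then 1 else 0 := by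
    intro S
    have e1 : J.X S = ∑ v ∈ S, (I.r v + b' v) -
      ∑ e ∈ I.F, if (I.ends e).1 ∈ S ∧ (I.ends e).2 ∈ S then 1 else 0 := rfl
    rw [e1, Finset.sum_add_distrib, hsum]
    unfold X
    rw [Finset.sum_add_distrib]; ring
  have hY : ∀ S, J.Y S = I.Y S := fun S => rfl
  have hU := hsum I.U
  rw [if_pos hv] at hU
  have : Sol k J := by
    refine IH J v0 (Or.inr ⟨rfl, ?_⟩) ⟨hI.endsU, hI.a0, ?_, ?_, hI.cong, ?_⟩
    · change ∑ v ∈ I.U, (I.a v + b' v) < _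
      rw [Finset.sum_add_distrib, Finset.sum_add_distrib, hU]; omega
    · intro x
      change 0 ≤ b' x
      have := hI.b0 x
      simp only [hb']
      split_ifs with h
      · subst h; omega
      · omega
    · have := hI.root
      change (∑ v ∈ I.U, I.a v ≤ 2 * k - 1 ∧ ∑ v ∈ I.U, b' v ≤ k - 1) ∨
        (∑ v ∈ I.U, I.a v ≤ k - 1 ∧ ∑ v ∈ I.U, b' v ≤ 2 * k - 1)
      rw [hU]; omega
    · intro S hS hne hneU
      left
      rcases set_cases hne with ⟨x, rfl⟩ | h2
      · by_cases hx : v = x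
        · subst hx
          obtain ⟨m, h1, h2⟩ := ho
          refine ⟨m, ?_, ?_⟩
          · rw [hX]; simp; omega
          · rw [hY]; exact h2
        · refine good_mono (hP.single (hS (by simp))) ?_ ?_
          · rw [hX]; simp [hx]
          · rw [hY]
      · refine good_drop (hP.hT S hS h2 hneU) ?_ ?_
        · rw [hX]; split_ifs <;> omega
        · rw [hY]; omega
  exact this

theorem caseP3 {k : ℤ} {I : OD V E} {v0 t h : V} (hI : Inst k I v0)
    (IH : ∀ (J : OD V E) (v1 : V), lt J I → Inst k J v1 → Sol k J) (hP : PC k I)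
    {e : E} (he : e ∈ I.F) (hj : I.Joins e t h) (hth : t ≠ h)
    (ht : Outb k I t) (hh : Inb k I h) : Sol k I := by
  have hX : ∀ S, (I.od e t I.a I.b).X S = I.X S - (if t ∈ S ∧ h ∉ S then 1 else 0) := by
    intro S; rw [X_od he hj]; simp
  have hY : ∀ S, (I.od e t I.a I.b).Y S = I.Y S - (if h ∈ S ∧ t ∉ S then 1 else 0) := by
    intro S; rw [Y_od he hj]; simp
  refine sol_od he hj (IH _ v0 (lt_od he)
    (inst_od (a' := I.a) (b' := I.b) hI he hj hI.a0 hI.b0 hI.root ?_))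
  intro S hS hne hneU
  left
  rcases set_cases hne with ⟨x, rfl⟩ | h2
  · by_cases hx : t = x
    · subst hx
      obtain ⟨m, h1, h2⟩ := ht
      refine ⟨m, ?_, ?_⟩
      · rw [hX]; split_ifs <;> omega
      · rw [hY]; simp; omega
    by_cases hx' : h = x
    · subst hx'
      obtain ⟨m, h1, h2⟩ := hh
      refine ⟨m, ?_, ?_⟩
      · rw [hX]; simp; omega
      · rw [hY]; split_ifs <;> omega
    · refine good_mono (hP.single (hS (by simp))) ?_ ?_
      · rw [hX]; simp [hx]
      · rw [hY]; simp [hx']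
  · refine good_drop (hP.hT S hS h2 hneU) ?_ ?_
    · rw [hX]; split_ifs <;> omega
    · rw [hY]; split_ifs <;> omega

theorem caseP5 {k : ℤ} (hk : 2 ≤ k) {I : OD V E} {v0 : V} (hI : Inst k I v0)
    (IH : ∀ (J : OD V E) (v1 : V), lt J I → Inst k J v1 → Sol k J) (hP : PC k I)
    (hall : ∀ v ∈ I.U, Outb k I v) : Sol k I := by
  by_cases hb : ∃ v ∈ I.U, 1 ≤ I.b v
  · obtain ⟨v, hv, hb⟩ := hb
    exact caseP1 hI IH hP hv hb (hall v hv)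
  push Not at hb
  have hb0 : ∀ v ∈ I.U, I.b v = 0 := fun v hv => le_antisymm (by have := hb v hv; omega) (hI.b0 v)
  have hbU : ∑ v ∈ I.U, I.b v = 0 := Finset.sum_eq_zero hb0
  have haU : ∑ v ∈ I.U, I.a v ≤ 2 * k - 1 := by
    rcases hI.root with h | h <;> omega
  have hedge : ∃ e ∈ I.F, (I.ends e).1 ≠ (I.ends e).2 := by
    by_contra hno
    push Not at hno
    have key : ∀ v ∈ I.U, 2 * k - 1 ≤ I.a v := by
      intro v hv
      have hD := I.X_add_Y {v}
      rw [Finset.sum_singleton, Finset.sum_singleton, hb0 v hv, Finset.sum_eq_zero] at hD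
      · obtain ⟨m, h1, h2⟩ := hall v hv
        linarith
      · intro e he
        rw [hno e he]
        simp
    obtain ⟨x, hx, y, hy, hxy⟩ := Finset.one_lt_card.1 (by have := hP.h2; omega : 1 < #I.U)
    have h1 : ∑ v ∈ ({x, y} : Finset V), I.a v ≤ ∑ v ∈ I.U, I.a v := by
      apply Finset.sum_le_sum_of_subset_of_nonneg
      · intro v hv; simp only [Finset.mem_insert, Finset.mem_singleton] at hv
        rcases hv with rfl | rfl <;> assumption
      · intro v _ _; exact hI.a0 v
    rw [Finset.sum_pair hxy] at h1
    have := key x hx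
    have := key y hy
    omega
  obtain ⟨e, he, hxy⟩ := hedge
  obtain ⟨x, y, hends⟩ : ∃ x y, I.ends e = (x, y) := ⟨_, _, rfl⟩
  rw [hends] at hxy
  simp only at hxy
  have hj : I.Joins e y x := Or.inr hends
  obtain ⟨hy, hx⟩ := hj.mem hI he
  obtain ⟨m, hm1, hm2⟩ := hall x hx
  set t : ℤ := max 0 (2 * k - 1 - (I.X {x} + m * k)) with ht
  have ht0 : 0 ≤ t := le_max_left _ _
  have ht1 : 2 * k - 1 - (I.X {x} + m * k) ≤ t := le_max_right _ _
  have ht2 : t ≤ k - 1 := max_le (by omega) (by omega)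
  set b' : V → ℤ := fun v => I.b v + if v = x then t else 0 with hb'
  have hsum : ∀ S : Finset V, ∑ v ∈ S, (b' v - I.b v) = if x ∈ S then t else 0 := by
    intro S
    simp only [hb', add_sub_cancel_left, Finset.sum_ite_eq']
  have hX : ∀ S, (I.od e y I.a b').X S = I.X S - (if y ∈ S ∧ x ∉ S then 1 else 0) +
      if x ∈ S then t else 0 := by
    intro S; rw [X_od he hj, hsum]
  have hY : ∀ S, (I.od e y I.a b').Y S = I.Y S - (if x ∈ S ∧ y ∉ S then 1 else 0) := by
    intro S; rw [Y_od he hj]; simp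
  refine sol_od he hj (IH _ v0 (lt_od he)
    (inst_od (a' := I.a) (b' := b') hI he hj hI.a0 ?_ ?_ ?_))
  · intro v
    have := hI.b0 v
    simp only [hb']
    split_ifs <;> omega
  · left
    refine ⟨haU, ?_⟩
    have := hsum I.U
    rw [Finset.sum_sub_distrib, hbU, if_pos hx] at this
    omega
  · intro S hS hne hneU
    left
    rcases set_cases hne with ⟨v, rfl⟩ | h2
    · by_cases hvx : x = v
      · subst hvx
        refine ⟨m - 1, ?_, ?_⟩
        · rw [hX]; simp; linarith
        · rw [hY]; simp [hxy.symm]; linarith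
      by_cases hvy : y = v
      · subst hvy
        obtain ⟨m', h1, h2⟩ := hall y hy
        refine ⟨m', ?_, ?_⟩
        · rw [hX]; simp [hxy]; omega
        · rw [hY]; simp [hxy]; omega
      · refine good_mono (hP.single (hS (by simp))) ?_ ?_
        · rw [hX]; simp [hvx, hvy]
        · rw [hY]; simp [hvx]
    · refine good_drop (hP.hT S hS h2 hneU) ?_ ?_
      · rw [hX]; split_ifs <;> omega
      · rw [hY]; split_ifs <;> omega

theorem caseP {k : ℤ} (hk : 2 ≤ k) {I : OD V E} {v0 : V} (hI : Inst k I v0)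
    (IH : ∀ (J : OD V E) (v1 : V), lt J I → Inst k J v1 → Sol k J) (hP : PC k I) : Sol k I := by
  classical
  by_cases hall : ∀ v ∈ I.U, Outb k I v
  · exact caseP5 hk hI IH hP hall
  by_cases hall' : ∀ v ∈ I.U, Inb k I v
  · exact sol_mirror (caseP5 hk (inst_mirror hI) (IH_mirror IH) hP.mirror
      fun v hv => (hall' v hv).mirror)
  by_cases h1 : ∃ v ∈ I.U, 1 ≤ I.b v ∧ Outb k I v
  · obtain ⟨v, hv, hb, ho⟩ := h1
    exact caseP1 hI IH hP hv hb ho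
  by_cases h2 : ∃ v ∈ I.U, 1 ≤ I.a v ∧ Inb k I v
  · obtain ⟨v, hv, ha, ho⟩ := h2
    exact sol_mirror (caseP1 (inst_mirror hI) (IH_mirror IH) hP.mirror (v := v) hv ha ho.mirror)
  by_cases h3 : ∃ e ∈ I.F, ∃ t h, I.Joins e t h ∧ t ≠ h ∧ Outb k I t ∧ Inb k I h
  · obtain ⟨e, he, t, h, hj, hth, ht, hh⟩ := h3
    exact caseP3 hI IH hP he hj hth ht hh
  exfalso
  push Not at hall hall' h1 h2 h3
  obtain ⟨n, hn, hno⟩ := hall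
  obtain ⟨p, hp, hpo⟩ := hall'
  have hpo' := (hP.hv p hp).resolve_right hpo
  have hnI : ∀ v ∈ I.U, ¬ Outb k I v → Inb k I v := fun v hv h => (hP.hv v hv).resolve_left h
  have key : ∀ S ⊆ I.U, S.Nonempty → S ≠ I.U →
      (∀ e ∈ I.F, ((I.ends e).1 ∈ S ↔ (I.ends e).2 ∈ S)) →
      2 * k - 2 ≤ ∑ v ∈ S, I.a v + ∑ v ∈ S, I.b v := by
    intro S hS hne hneU hc
    have hD := I.X_add_Y S
    rw [Finset.sum_eq_zero (s := I.F)] at hD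
    · obtain ⟨m, h4, h5⟩ := hP.good hS hne hneU
      linarith
    · intro e he
      have := hc e he
      rw [if_neg]; tauto
  have hnoedge : ∀ e ∈ I.F, (Outb k I (I.ends e).1 ↔ Outb k I (I.ends e).2) := by
    intro e he
    have hU := hI.endsU e he
    by_contra hne
    have : ∀ t h, I.Joins e t h → Outb k I t → ¬ Outb k I h → False := by
      intro t h hj ht hh
      refine h3 e he t h hj ?_ ht (hnI h (hj.mem hI he).2 hh)
      rintro rfl; exact hh ht
    have a1 := this (I.ends e).1 (I.ends e).2 (Or.inl rfl)
    have a2 := this (I.ends e).2 (I.ends e).1 (Or.inr rfl)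
    tauto
  have kP := key (I.U.filter fun v => Outb k I v) (Finset.filter_subset _ _)
    ⟨p, Finset.mem_filter.2 ⟨hp, hpo'⟩⟩ (fun h => hno (by
      rw [← h] at hn; exact (Finset.mem_filter.1 hn).2)) (by
      intro e he
      have := hI.endsU e he
      have := hnoedge e he
      simp only [Finset.mem_filter]; tauto)
  have kN := key (I.U.filter fun v => ¬ Outb k I v) (Finset.filter_subset _ _)
    ⟨n, Finset.mem_filter.2 ⟨hn, hno⟩⟩ (fun h => by
      rw [← h] at hp; exact (Finset.mem_filter.1 hp).2 hpo') (by
      intro e he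
      have := hI.endsU e he
      have := hnoedge e he
      simp only [Finset.mem_filter]; tauto)
  have zP : ∑ v ∈ I.U.filter (fun v => Outb k I v), I.b v = 0 := by
    refine Finset.sum_eq_zero fun v hv => ?_
    obtain ⟨hv1, hv2⟩ := Finset.mem_filter.1 hv
    have := hI.b0 v
    by_contra h
    exact h1 v hv1 (by omega) hv2
  have zN : ∑ v ∈ I.U.filter (fun v => ¬ Outb k I v), I.a v = 0 := by
    refine Finset.sum_eq_zero fun v hv => ?_
    obtain ⟨hv1, hv2⟩ := Finset.mem_filter.1 hv
    have := hI.a0 v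
    by_contra h
    exact h2 v hv1 (by omega) (hnI v hv1 hv2)
  have sA := Finset.sum_filter_add_sum_filter_not I.U (fun v => Outb k I v) I.a
  have sB := Finset.sum_filter_add_sum_filter_not I.U (fun v => Outb k I v) I.b
  have := hI.root
  omega

theorem main_step {k : ℤ} (hk : 2 ≤ k) {I : OD V E} {v0 : V} (hI : Inst k I v0)
    (IH : ∀ (J : OD V E) (v1 : V), lt J I → Inst k J v1 → Sol k J) : Sol k I := by
  by_cases h2 : 2 ≤ #I.U
  swap
  · refine ⟨fun _ => true, fun v hv => ?_⟩
    have hUv : I.U = {v} := by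
      rcases set_cases ⟨v, hv⟩ with ⟨x, hx⟩ | h
      · rw [hx] at hv; simp only [Finset.mem_singleton] at hv; rw [hx, hv]
      · exact absurd h h2
    have h1 := hI.cong
    rw [hUv, Finset.sum_singleton] at h1
    rw [Finset.sum_congr rfl (s₁ := I.F) (g := fun _ => (1:ℤ))]
    · rw [← dvd_neg] at h1
      refine h1.trans (dvd_of_eq ?_)
      simp
    · intro e he
      have := hI.endsU e he
      rw [hUv] at this
      simp only [Finset.mem_singleton] at this
      unfold tl
      simp [this]
  by_cases hT : ∃ S ⊆ I.U, 2 ≤ #S ∧ S ≠ I.U ∧ ¬ Good k k I S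
  · obtain ⟨S, hS, h3, h4, h5⟩ := hT
    exact caseT hI IH hS h3 h4 h5
  push Not at hT
  by_cases hz : ∃ z, ZC k I z
  · obtain ⟨z, hz⟩ := hz
    exact caseZ hk hI IH hz
  have hsU : ∀ v, ({v} : Finset V) ≠ I.U := by
    intro v h; rw [← h] at h2; simp at h2
  have hsing : ∀ v ∈ I.U, Good k (k - 1) I {v} := by
    intro v hv
    rcases hI.good {v} (by simpa using hv) (by simp) (hsU v) with h | ⟨h, h'⟩
    · exact h
    · exfalso
      apply hz
      refine ⟨v, hv, h2, hT, h', ?_⟩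
      intro w hw hwv
      rcases hI.good {w} (by simpa using hw) (by simp) (hsU w) with h3 | ⟨h3, _⟩
      · exact h3
      · rw [← h3] at h
        exact absurd (Finset.singleton_injective h).symm hwv
  refine caseP hk hI IH ⟨h2, hT, ?_⟩
  intro v hv
  obtain ⟨m, h3, h4⟩ := hsing v hv
  by_cases h5 : k ≤ I.X {v} + m * k
  · exact Or.inl ⟨m, h5, h4⟩
  by_cases h6 : k ≤ I.Y {v} - m * k
  · exact Or.inr ⟨m, h3, h6⟩
  exact absurd ⟨v, hv, h2, hT, ⟨m, by omega⟩, fun w hw _ => hsing w hw⟩ hz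

theorem main {k : ℤ} (hk : 2 ≤ k) : ∀ (n t : ℕ) (I : OD V E) (v0 : V),
    #I.U + #I.F = n → (∑ v ∈ I.U, (I.a v + I.b v)).toNat = t → Inst k I v0 → Sol k I := by
  intro n
  induction n using Nat.strong_induction_on with
  | _ n ih1 =>
  intro t
  induction t using Nat.strong_induction_on with
  | _ t ih2 =>
  intro I v0 hn ht hI
  refine main_step hk hI fun J v1 hlt hJ => ?_
  rcases hlt with h | ⟨h, h'⟩
  · exact ih1 _ (by omega) _ J v1 rfl rfl hJ
  · have : 0 ≤ ∑ v ∈ J.U, (J.a v + J.b v) :=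
      Finset.sum_nonneg fun v _ => add_nonneg (hJ.a0 v) (hJ.b0 v)
    exact ih2 _ (by omega) J v1 (by omega) rfl hJ

end
end OD

section colouring
variable [DecidableEq V] [DecidableEq E]

/-- `t` has classes of size at most two on `F`. -/
def AtMostTwo (F : Finset E) (t : E → E) : Prop :=
  ∀ x ∈ F, ∀ y ∈ F, ∀ z ∈ F, x ≠ y → y ≠ z → x ≠ z → t x = t y → t y = t z → False

def Bichrom (F : Finset E) (t : E → E) (g : E → Bool) : Prop :=
  ∀ x ∈ F, ∀ y ∈ F, x ≠ y → t x = t y → g x ≠ g y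

theorem bool_flip : ∀ a b : Bool, a ≠ b → b = !a := by decide

theorem two_colour_step (F : Finset E) (t h : E → E) (ht : AtMostTwo F t) (hh : AtMostTwo F h)
    (IH : ∀ F' ⊂ F, ∀ t' h' : E → E, AtMostTwo F' t' → AtMostTwo F' h' →
      ∃ g, Bichrom F' t' g ∧ Bichrom F' h' g)
    {e f : E} (he : e ∈ F) (hf : f ∈ F) (hef : e ≠ f) (htef : t e = t f) :
    ∃ g, Bichrom F t g ∧ Bichrom F h g := by
  set F' := (F.erase e).erase f with hF'
  have hmem : ∀ x, x ∈ F' ↔ x ≠ f ∧ x ≠ e ∧ x ∈ F := fun x => by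
    simp only [hF', Finset.mem_erase]
  have hsub : F' ⊂ F := by
    refine Finset.ssubset_iff_subset_ne.2 ⟨fun x hx => ((hmem x).1 hx).2.2, ?_⟩
    intro h; rw [← h] at he; exact ((hmem e).1 he).2.1 rfl
  have ht' : AtMostTwo F' t := fun x hx y hy z hz =>
    ht x ((hmem x).1 hx).2.2 y ((hmem y).1 hy).2.2 z ((hmem z).1 hz).2.2
  set h' : E → E := fun x => if h x = h f then h e else h x with hh'
  have u1 : ∀ x ∈ F', ∀ y ∈ F', h x = h e → h y = h e → x = y := by
    intro x hx y hy h1 h2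
    by_contra hne
    exact hh x ((hmem x).1 hx).2.2 y ((hmem y).1 hy).2.2 e he hne ((hmem y).1 hy).2.1
      ((hmem x).1 hx).2.1 (h1.trans h2.symm) h2
  have u2 : ∀ x ∈ F', ∀ y ∈ F', h x = h f → h y = h f → x = y := by
    intro x hx y hy h1 h2
    by_contra hne
    exact hh x ((hmem x).1 hx).2.2 y ((hmem y).1 hy).2.2 f hf hne ((hmem y).1 hy).1
      ((hmem x).1 hx).1 (h1.trans h2.symm) h2
  have u3 : h e = h f → ∀ x ∈ F', h x ≠ h f := by
    intro h1 x hx h2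
    exact hh e he f hf x ((hmem x).1 hx).2.2 hef ((hmem x).1 hx).1.symm ((hmem x).1 hx).2.1.symm
      h1 h2.symm
  have ht3 : ∀ x ∈ F', t x ≠ t e := by
    intro x hx h2
    exact ht e he f hf x ((hmem x).1 hx).2.2 hef ((hmem x).1 hx).1.symm ((hmem x).1 hx).2.1.symm
      htef (htef.symm.trans h2.symm)
  have hh2 : AtMostTwo F' h' := by
    intro x hx y hy z hz hxy hyz hxz h1 h2
    have o := hh x ((hmem x).1 hx).2.2 y ((hmem y).1 hy).2.2 z ((hmem z).1 hz).2.2 hxy hyz hxz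
    have a1 := u1 x hx y hy
    have a2 := u1 y hy z hz
    have a3 := u1 x hx z hz
    have b1 := u2 x hx y hy
    have b2 := u2 y hy z hz
    have b3 := u2 x hx z hz
    simp only [hh'] at h1 h2
    split_ifs at h1 h2 <;> grind
  obtain ⟨g, hg1, hg2⟩ := IH F' hsub t h' ht' hh2
  obtain ⟨be, hbe1, hbe2⟩ : ∃ be : Bool, (∀ x ∈ F', h x = h e → g x ≠ be) ∧
      (∀ x ∈ F', h x = h f → g x = be) := by
    by_cases hef' : h e = h f
    · refine ⟨true, fun x hx h1 => ?_, fun x hx h1 => ?_⟩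
      · exact absurd (h1.trans hef') (u3 hef' x hx)
      · exact absurd h1 (u3 hef' x hx)
    by_cases c1 : ∃ x ∈ F', h x = h e
    · obtain ⟨x, hx, hxe⟩ := c1
      refine ⟨!(g x), fun y hy hye => ?_, fun y hy hyf => ?_⟩
      · rw [u1 y hy x hx hye hxe]; simp
      · have hxy : x ≠ y := by rintro rfl; exact hef' (hxe.symm.trans hyf)
        have := hg2 x hx y hy hxy (by
          simp only [hh']
          rw [if_neg (by rw [hxe]; exact hef'), if_pos hyf, hxe])
        exact bool_flip _ _ this
    · push Not at c1
      by_cases c2 : ∃ x ∈ F', h x = h f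
      · obtain ⟨x, hx, hxe⟩ := c2
        refine ⟨g x, fun y hy hye => absurd hye (c1 y hy), fun y hy hyf => ?_⟩
        rw [u2 y hy x hx hyf hxe]
      · push Not at c2
        exact ⟨true, fun y hy hye => absurd hye (c1 y hy), fun y hy hye => absurd hye (c2 y hy)⟩
  set G : E → Bool := fun x => if x = e then be else if x = f then !be else g x with hG
  have Ge : G e = be := by simp [hG]
  have Gf : G f = !be := by simp [hG, hef.symm]
  have GF : ∀ x ∈ F', G x = g x := by
    intro x hx
    have := (hmem x).1 hx
    simp [hG, this.1, this.2.1]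
  have tri : ∀ x ∈ F, x = e ∨ x = f ∨ x ∈ F' := by
    intro x hx
    rw [hmem]; tauto
  have nb : be ≠ !be := by cases be <;> simp
  refine ⟨G, ?_, ?_⟩
  · intro x hx y hy hxy h1
    rcases tri x hx with rfl | rfl | hx' <;> rcases tri y hy with rfl | rfl | hy'
    · exact absurd rfl hxy
    · rw [Ge, Gf]; exact nb
    · exact absurd h1.symm (ht3 y hy')
    · rw [Ge, Gf]; exact nb.symm
    · exact absurd rfl hxy
    · exact absurd (h1.symm.trans htef.symm) (ht3 y hy')
    · exact absurd h1 (ht3 x hx')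
    · exact absurd (h1.trans htef.symm) (ht3 x hx')
    · rw [GF x hx', GF y hy']; exact hg1 x hx' y hy' hxy h1
  · intro x hx y hy hxy h1
    rcases tri x hx with rfl | rfl | hx' <;> rcases tri y hy with rfl | rfl | hy'
    · exact absurd rfl hxy
    · rw [Ge, Gf]; exact nb
    · rw [Ge, GF y hy']; exact (hbe1 y hy' h1.symm).symm
    · rw [Ge, Gf]; exact nb.symm
    · exact absurd rfl hxy
    · rw [Gf, GF y hy', hbe2 y hy' h1.symm]; exact nb.symm
    · rw [Ge, GF x hx']; exact hbe1 x hx' h1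
    · rw [Gf, GF x hx', hbe2 x hx' h1]; exact nb
    · rw [GF x hx', GF y hy']
      refine hg2 x hx' y hy' hxy ?_
      simp only [hh', h1]

theorem two_colour (F : Finset E) : ∀ (t h : E → E), AtMostTwo F t → AtMostTwo F h →
    ∃ g, Bichrom F t g ∧ Bichrom F h g := by
  induction F using Finset.strongInduction with
  | H F IH =>
  intro t h ht hh
  by_cases h1 : ∃ e ∈ F, ∃ f ∈ F, e ≠ f ∧ t e = t f
  · obtain ⟨e, he, f, hf, hef, htef⟩ := h1
    exact two_colour_step F t h ht hh IH he hf hef htef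
  by_cases h2 : ∃ e ∈ F, ∃ f ∈ F, e ≠ f ∧ h e = h f
  · obtain ⟨e, he, f, hf, hef, htef⟩ := h2
    obtain ⟨g, g1, g2⟩ := two_colour_step F h t hh ht IH he hf hef htef
    exact ⟨g, g2, g1⟩
  push Not at h1 h2
  exact ⟨fun _ => true, fun x hx y hy hxy h => absurd h (h1 x hx y hy hxy),
    fun x hx y hy hxy h => absurd h (h2 x hx y hy hxy)⟩

def sg (b : Bool) : ℤ := if b = true then 1 else -1

theorem sg_ne {a b : Bool} (h : a ≠ b) : sg a + sg b = 0 := by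
  cases a <;> cases b <;> simp_all [sg]

theorem abs_sg (a : Bool) : |sg a| ≤ 1 := by cases a <;> simp [sg]

theorem sum_le_one_of_card {F : Finset E} (h : #F ≤ 1) (g : E → Bool) :
    |∑ e ∈ F, sg (g e)| ≤ 1 := by
  by_cases hn : F.Nonempty
  · obtain ⟨x, hx⟩ := Finset.card_eq_one.1 (le_antisymm h (Finset.card_pos.2 hn))
    rw [hx, Finset.sum_singleton]; exact abs_sg _
  · rw [Finset.not_nonempty_iff_eq_empty.1 hn]; simp

theorem refine_two (t : E → V) (F : Finset E) : ∃ t' : E → E, (∀ x ∈ F, t' x ∈ F) ∧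
    AtMostTwo F t' ∧ ∀ g : E → Bool, Bichrom F t' g → |∑ e ∈ F, sg (g e)| ≤ 1 ∧
      ∀ v, |∑ e ∈ F.filter (fun e => t e = v), sg (g e)| ≤ 1 := by
  induction F using Finset.strongInduction with
  | H F IH =>
  by_cases hcard : #F ≤ 1
  · refine ⟨id, fun x hx => hx, fun x _ y _ z _ hxy _ _ h _ => hxy h, fun g _ =>
      ⟨sum_le_one_of_card hcard g, fun v => sum_le_one_of_card ?_ g⟩⟩
    exact (Finset.card_filter_le _ _).trans hcard
  obtain ⟨e, he, f, hf, hef, hor⟩ : ∃ e ∈ F, ∃ f ∈ F, e ≠ f ∧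
      (t e = t f ∨ ∀ x ∈ F, ∀ y ∈ F, t x = t y → x = y) := by
    by_cases h : ∃ e ∈ F, ∃ f ∈ F, e ≠ f ∧ t e = t f
    · obtain ⟨e, he, f, hf, hef, h⟩ := h
      exact ⟨e, he, f, hf, hef, Or.inl h⟩
    · push Not at h
      obtain ⟨e, he, f, hf, hef⟩ := Finset.one_lt_card.1 (not_le.1 hcard)
      refine ⟨e, he, f, hf, hef, Or.inr fun x hx y hy hxy => ?_⟩
      by_contra hne
      exact h x hx y hy hne hxy
  set F' := (F.erase e).erase f with hF'
  have hmem : ∀ x, x ∈ F' ↔ x ≠ f ∧ x ≠ e ∧ x ∈ F := fun x => by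
    simp only [hF', Finset.mem_erase]
  have hsub : F' ⊂ F := by
    refine Finset.ssubset_iff_subset_ne.2 ⟨fun x hx => ((hmem x).1 hx).2.2, ?_⟩
    intro h; rw [← h] at he; exact ((hmem e).1 he).2.1 rfl
  obtain ⟨t', h1, h2, h3⟩ := IH F' hsub
  set T : E → E := fun x => if x = e ∨ x = f then e else t' x with hT
  have Te : T e = e := by simp [hT]
  have Tf : T f = e := by simp [hT]
  have TF : ∀ x ∈ F', T x = t' x := by
    intro x hx
    have := (hmem x).1 hx
    simp [hT, this.1, this.2.1]
  have TFe : ∀ x ∈ F', T x ≠ e := by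
    intro x hx h
    rw [TF x hx] at h
    have := h1 x hx
    rw [h] at this
    exact ((hmem e).1 this).2.1 rfl
  have tri : ∀ x ∈ F, x = e ∨ x = f ∨ x ∈ F' := by
    intro x hx
    rw [hmem]; tauto
  have Tcls : ∀ x ∈ F, T x = e → x = e ∨ x = f := by
    intro x hx h
    rcases tri x hx with h' | h' | h'
    · exact Or.inl h'
    · exact Or.inr h'
    · exact absurd h (TFe x h')
  have Tcls' : ∀ x ∈ F, T x ≠ e → x ∈ F' := by
    intro x hx h
    rcases tri x hx with rfl | rfl | h'
    · exact absurd Te h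
    · exact absurd Tf h
    · exact h'
  have hfe : f ∈ F.erase e := Finset.mem_erase.2 ⟨hef.symm, hf⟩
  refine ⟨T, ?_, ?_, ?_⟩
  · intro x hx
    by_cases h : T x = e
    · rw [h]; exact he
    · have := Tcls' x hx h
      rw [TF x this]; exact ((hmem _).1 (h1 x this)).2.2
  · intro x hx y hy z hz hxy hyz hxz e1 e2
    by_cases h : T x = e
    · rcases Tcls x hx h with a | a <;> rcases Tcls y hy (e1 ▸ h) with b | b <;>
        rcases Tcls z hz (e2 ▸ e1 ▸ h) with c | c <;> subst a <;> simp_all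
    · have hx' := Tcls' x hx h
      have hy' := Tcls' y hy (e1 ▸ h)
      have hz' := Tcls' z hz (e2 ▸ e1 ▸ h)
      rw [TF x hx', TF y hy'] at e1
      rw [TF y hy', TF z hz'] at e2
      exact h2 x hx' y hy' z hz' hxy hyz hxz e1 e2
  · intro g hg
    have hg' : Bichrom F' t' g := by
      intro x hx y hy hxy hh
      refine hg x ((hmem x).1 hx).2.2 y ((hmem y).1 hy).2.2 hxy ?_
      rw [TF x hx, TF y hy, hh]
    obtain ⟨b1, b2⟩ := h3 g hg'
    have hz := sg_ne (hg e he f hf hef (by rw [Te, Tf]))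
    refine ⟨?_, fun v => ?_⟩
    · rw [← Finset.add_sum_erase _ _ he, ← Finset.add_sum_erase _ _ hfe, ← add_assoc, hz, zero_add]
      exact b1
    · rcases hor with hor | hinj
      · have := b2 v
        rw [Finset.sum_filter] at this ⊢
        rw [← Finset.add_sum_erase _ _ he, ← Finset.add_sum_erase _ _ hfe, ← add_assoc, ← hor]
        have z2 : (if t e = v then sg (g e) else 0) + (if t e = v then sg (g f) else 0) = 0 := by
          split_ifs
          · exact hz
          · simp
        rw [z2, zero_add]
        exact this
      · apply sum_le_one_of_card
        rw [Finset.card_le_one]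
        intro x hx y hy
        rw [Finset.mem_filter] at hx hy
        exact hinj x hx.1 y hy.1 (hx.2.trans hy.2.symm)

theorem balanced_two (t h : E → V) (F : Finset E) : ∃ g : E → Bool,
    |∑ e ∈ F, sg (g e)| ≤ 1 ∧ (∀ v, |∑ e ∈ F.filter (fun e => t e = v), sg (g e)| ≤ 1) ∧
    (∀ v, |∑ e ∈ F.filter (fun e => h e = v), sg (g e)| ≤ 1) := by
  obtain ⟨t', _, t2, t3⟩ := refine_two t F
  obtain ⟨h', _, h2, h3⟩ := refine_two h F
  obtain ⟨g, g1, g2⟩ := two_colour F t' h' t2 h2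
  exact ⟨g, (t3 g g1).1, (t3 g g1).2, (h3 g g2).2⟩

end colouring

section kcolouring
variable [DecidableEq V] [DecidableEq E]

def clsCnt [Fintype E] {K : Type*} {k : ℕ} (q : K → E → Prop) [∀ κ e, Decidable (q κ e)]
    (c : E → Fin k) (κ : K) (i : Fin k) : ℤ :=
  ∑ e, if q κ e ∧ c e = i then 1 else 0

theorem k_colour [Fintype E] {K : Type*} [Fintype K] {k : ℕ} (hk : 0 < k)
    (q : K → E → Prop) [∀ κ e, Decidable (q κ e)]
    (hB : ∀ F : Finset E, ∃ g : E → Bool, ∀ κ, |∑ e ∈ F, if q κ e then sg (g e) else 0| ≤ 1) :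
    ∃ c : E → Fin k, ∀ κ i j, clsCnt q c κ i - clsCnt q c κ j ≤ 1 := by
  haveI : Nonempty (Fin k) := ⟨⟨0, hk⟩⟩
  obtain ⟨c, hc⟩ := Finite.exists_min
    (fun c : E → Fin k => ∑ κ, ∑ i, (clsCnt q c κ i) ^ 2)
  refine ⟨c, ?_⟩
  by_contra hcon
  push Not at hcon
  obtain ⟨κ0, i, j, hlt⟩ := hcon
  have hij : i ≠ j := by rintro rfl; simp at hlt
  set F : Finset E := univ.filter (fun e => c e = i ∨ c e = j) with hF
  obtain ⟨g, hg⟩ := hB F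
  set c' : E → Fin k := fun e => if c e = i ∨ c e = j then (if g e = true then i else j) else c e
    with hc'
  have s1 : ∀ κ l, l ≠ i ∧ l ≠ j → clsCnt q c' κ l = clsCnt q c κ l := by
    rintro κ l ⟨h1, h2⟩
    refine Finset.sum_congr rfl fun e _ => ?_
    have : c' e = l ↔ c e = l := by
      simp only [hc']
      split_ifs with h3 h4
      · rcases h3 with h3 | h3 <;> rw [h3] <;> simp [h1.symm, h2.symm]
      · rcases h3 with h3 | h3 <;> rw [h3] <;> simp [h1.symm, h2.symm]
      · rfl
    simp only [this]
  have s2 : ∀ κ, clsCnt q c' κ i + clsCnt q c' κ j = clsCnt q c κ i + clsCnt q c κ j := by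
    intro κ
    unfold clsCnt
    rw [← Finset.sum_add_distrib, ← Finset.sum_add_distrib]
    refine Finset.sum_congr rfl fun e _ => ?_
    by_cases hq : q κ e
    · simp only [hq, true_and, hc']
      by_cases h3 : c e = i
      · cases g e <;> simp [h3, hij, hij.symm]
      · by_cases h4 : c e = j
        · cases g e <;> simp [h4, hij, hij.symm]
        · simp [h3, h4]
    · simp [hq]
  have s3 : ∀ κ, clsCnt q c' κ i - clsCnt q c' κ j = ∑ e ∈ F, if q κ e then sg (g e) else 0 := by
    intro κ
    unfold clsCnt
    rw [← Finset.sum_sub_distrib, hF, Finset.sum_filter]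
    refine Finset.sum_congr rfl fun e _ => ?_
    by_cases hq : q κ e
    · simp only [hq, true_and, hc', if_true]
      by_cases h3 : c e = i ∨ c e = j
      · simp only [h3, if_true]
        cases g e <;> simp [hij, hij.symm, sg]
      · have h4 := not_or.1 h3
        simp [h4.1, h4.2]
    · simp [hq]
  have key : ∀ κ, ∑ l, (clsCnt q c κ l) ^ 2 - ∑ l, (clsCnt q c' κ l) ^ 2 =
      ((clsCnt q c κ i) ^ 2 - (clsCnt q c' κ i) ^ 2) +
        ((clsCnt q c κ j) ^ 2 - (clsCnt q c' κ j) ^ 2) := by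
    intro κ
    rw [← Finset.sum_sub_distrib]
    refine Fintype.sum_eq_add i j hij fun x hx => ?_
    rw [s1 κ x hx, sub_self]
  have alg : ∀ x y x' y' : ℤ, x' + y' = x + y → |x' - y'| ≤ 1 →
      x' ^ 2 + y' ^ 2 ≤ x ^ 2 + y ^ 2 ∧ (1 < x - y → x' ^ 2 + y' ^ 2 < x ^ 2 + y ^ 2) := by
    intro x y x' y' h1 h2
    have e1 : 2 * (x ^ 2 + y ^ 2) = (x + y) ^ 2 + (x - y) ^ 2 := by ring
    have e2 : 2 * (x' ^ 2 + y' ^ 2) = (x + y) ^ 2 + (x' - y') ^ 2 := by rw [← h1]; ring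
    have h3 := abs_le.1 h2
    have par : (x' - y') = (x - y) + 2 * (y - y') := by linarith
    constructor
    · have : (x' - y') ^ 2 ≤ (x - y) ^ 2 := by
        have h4 : x' - y' = 0 ∨ |x' - y'| = 1 := by
          rw [abs_eq (by norm_num)]; omega
        rcases h4 with h4 | h4
        · rw [h4]; nlinarith [sq_nonneg (x - y)]
        · rw [← sq_abs, h4]
          have : x - y ≠ 0 := by
            intro h5
            rw [abs_eq (by norm_num)] at h4
            omega
          have := Int.one_le_abs this
          rw [← sq_abs (x - y)]; nlinarith
      linarith
    · intro h5
      have : (x' - y') ^ 2 ≤ 1 := by nlinarith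
      nlinarith
  have fin : ∑ κ, ∑ l, (clsCnt q c' κ l) ^ 2 < ∑ κ, ∑ l, (clsCnt q c κ l) ^ 2 := by
    refine Finset.sum_lt_sum (fun κ _ => ?_) ⟨κ0, Finset.mem_univ _, ?_⟩
    · have h1 := (alg _ _ _ _ (s2 κ) (by rw [s3]; exact hg κ)).1
      have := key κ
      linarith
    · have h1 := (alg _ _ _ _ (s2 κ0) (by rw [s3]; exact hg κ0)).2 hlt
      have := key κ0
      linarith
  exact absurd (hc c') (not_le.2 fin)

theorem k_colour_graph [Fintype V] [Fintype E] (t h : E → V) {k : ℕ} (hk : 0 < k) :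
    ∃ c : E → Fin k,
      (∀ i j, (∑ e, if c e = i then (1 : ℤ) else 0) - (∑ e, if c e = j then (1 : ℤ) else 0) ≤ 1) ∧
      (∀ v i j, (∑ e, if t e = v ∧ c e = i then (1 : ℤ) else 0) -
        (∑ e, if t e = v ∧ c e = j then (1 : ℤ) else 0) ≤ 1) ∧
      (∀ v i j, (∑ e, if h e = v ∧ c e = i then (1 : ℤ) else 0) -
        (∑ e, if h e = v ∧ c e = j then (1 : ℤ) else 0) ≤ 1) := by
  let q : Option (V ⊕ V) → E → Prop := fun κ e =>
    match κ with
    | none => True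
    | some (Sum.inl v) => t e = v
    | some (Sum.inr v) => h e = v
  letI hq : ∀ κ e, Decidable (q κ e) := fun κ e =>
    match κ with
    | none => (inferInstance : Decidable True)
    | some (Sum.inl v) => (inferInstance : Decidable (t e = v))
    | some (Sum.inr v) => (inferInstance : Decidable (h e = v))
  obtain ⟨c, hc⟩ := k_colour hk q (by
    intro F
    obtain ⟨g, g1, g2, g3⟩ := balanced_two t h F
    refine ⟨g, ?_⟩
    rintro (_ | v | v)
    · simpa [q] using g1
    · have := g2 v
      rw [Finset.sum_filter] at this
      exact this
    · have := g3 v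
      rw [Finset.sum_filter] at this
      exact this)
  refine ⟨c, fun i j => ?_, fun v i j => ?_, fun v i j => ?_⟩
  · have := hc none i j
    simpa [q, clsCnt, -Finset.sum_boole] using this
  · have := hc (some (Sum.inl v)) i j
    exact this
  · have := hc (some (Sum.inr v)) i j
    exact this

theorem sum_diff {k : ℕ} (x : Fin k → ℤ) (i : Fin k) :
    (k : ℤ) * x i - ∑ j, x j = ∑ j, (x i - x j) := by
  rw [Finset.sum_sub_distrib]; simp

theorem avg_bounds {k : ℕ} (x : Fin k → ℤ) (hx : ∀ i j, x i - x j ≤ 1) (i : Fin k) :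
    (k : ℤ) * x i - ∑ j, x j < k ∧ -(k : ℤ) < (k : ℤ) * x i - ∑ j, x j := by
  rw [sum_diff]
  have hc : ∑ j : Fin k, (1 : ℤ) = k := by simp
  have hc' : ∑ j : Fin k, (-1 : ℤ) = -k := by simp
  constructor
  · rw [← hc]
    exact Finset.sum_lt_sum (fun j _ => hx i j) ⟨i, Finset.mem_univ _, by simp⟩
  · rw [← hc']
    exact Finset.sum_lt_sum (fun j _ => by have := hx j i; linarith) ⟨i, Finset.mem_univ _, by simp⟩

theorem avg_lt {k : ℕ} (x : Fin k → ℤ) (hx : ∀ i j, x i - x j ≤ 1) (i : Fin k) :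
    |(x i : ℝ) - ((∑ j, x j : ℤ) : ℝ) / (k : ℝ)| < 1 := by
  have hk : (0 : ℝ) < k := by
    have := i.pos
    exact_mod_cast this
  obtain ⟨h1, h2⟩ := avg_bounds x hx i
  have h1' : (k : ℝ) * x i - ((∑ j, x j : ℤ) : ℝ) < k := by exact_mod_cast h1
  have h2' : -(k : ℝ) < (k : ℝ) * x i - ((∑ j, x j : ℤ) : ℝ) := by exact_mod_cast h2
  have e : (x i : ℝ) - ((∑ j, x j : ℤ) : ℝ) / (k : ℝ) =
      ((k : ℝ) * x i - ((∑ j, x j : ℤ) : ℝ)) / k := by field_simp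
  rw [e, abs_lt, lt_div_iff₀ hk, div_lt_iff₀ hk]
  constructor <;> linarith

theorem avg_eq {k : ℕ} (x : Fin k → ℤ) (hx : ∀ i j, x i - x j ≤ 1) (hd : (k : ℤ) ∣ ∑ j, x j)
    (i j : Fin k) : x i = x j := by
  have hk : (0 : ℤ) < k := by
    have := i.pos
    exact_mod_cast this
  have : ∀ i, (k : ℤ) * x i = ∑ j, x j := by
    intro i
    obtain ⟨h1, h2⟩ := avg_bounds x hx i
    have hd' : (k : ℤ) ∣ (k : ℤ) * x i - ∑ j, x j := dvd_sub (dvd_mul_right _ _) hd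
    have := Int.eq_zero_of_abs_lt_dvd hd' (abs_lt.2 ⟨h2, h1⟩)
    linarith
  have h3 := (this i).trans (this j).symm
  exact mul_left_cancel₀ hk.ne' h3

end kcolouring

open scoped Pointwise in
theorem subset_sums_card {V : Type*} [DecidableEq V] {k : ℕ} (hk : Nat.Prime k) (d : V → ZMod k)
    (P : Finset V) (hP : ∀ v ∈ P, d v ≠ 0) :
    min k (#P + 1) ≤ #(P.powerset.image fun T => ∑ v ∈ T, d v) := by
  induction P using Finset.induction_on with
  | empty => simp
  | insert w P hw ih =>
    have ih' := ih fun v hv => hP v (Finset.mem_insert_of_mem hv)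
    have hdw : d w ≠ 0 := hP w (Finset.mem_insert_self _ _)
    set A := P.powerset.image fun T => ∑ v ∈ T, d v with hA
    have hAne : A.Nonempty := ⟨_, Finset.mem_image_of_mem _ (Finset.empty_mem_powerset P)⟩
    have cd := ZMod.cauchy_davenport hk hAne (t := ({0, d w} : Finset (ZMod k))) ⟨0, by simp⟩
    rw [Finset.card_pair hdw.symm] at cd
    have hsub : A + ({0, d w} : Finset (ZMod k)) ⊆ (insert w P).powerset.image fun T => ∑ v ∈ T, d v := by
      intro z hz
      obtain ⟨x, hx, y, hy, rfl⟩ := Finset.mem_add.1 hz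
      obtain ⟨T, hT, rfl⟩ := Finset.mem_image.1 hx
      rw [Finset.mem_powerset] at hT
      simp only [Finset.mem_insert, Finset.mem_singleton] at hy
      rcases hy with rfl | rfl
      · exact Finset.mem_image.2 ⟨T, Finset.mem_powerset.2 (hT.trans (Finset.subset_insert _ _)),
          by simp⟩
      · refine Finset.mem_image.2 ⟨insert w T, Finset.mem_powerset.2
          (Finset.insert_subset_insert _ hT), ?_⟩
        rw [Finset.sum_insert fun h => hw (hT h), add_comm]
    have := Finset.card_le_card hsub
    rw [Finset.card_insert_of_notMem hw]
    omega

theorem subset_sums {V : Type*} [DecidableEq V] {k : ℕ} (hk : Nat.Prime k) (d : V → ZMod k)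
    (P : Finset V) (hP : ∀ v ∈ P, d v ≠ 0) (hc : k - 1 ≤ #P) (z : ZMod k) :
    ∃ T ⊆ P, ∑ v ∈ T, d v = z := by
  haveI : NeZero k := ⟨hk.ne_zero⟩
  have h := subset_sums_card hk d P hP
  rw [min_eq_left (by omega)] at h
  have hu : (P.powerset.image fun T => ∑ v ∈ T, d v) = univ := by
    rw [← Finset.card_eq_iff_eq_univ]
    refine le_antisymm (Finset.card_le_univ _) ?_
    rwa [ZMod.card]
  have := Finset.mem_univ z
  rw [← hu] at this
  obtain ⟨T, hT, h⟩ := Finset.mem_image.1 this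
  exact ⟨T, Finset.mem_powerset.1 hT, h⟩

section final
variable [DecidableEq V] [DecidableEq E]

theorem mdeg_int (ends : E → V × V) (S : Finset E) (v : V) :
    (mdeg ends S v : ℤ) = (∑ e ∈ S, if (ends e).1 = v then (1 : ℤ) else 0) +
      ∑ e ∈ S, if (ends e).2 = v then (1 : ℤ) else 0 := by
  unfold mdeg
  simp

theorem mdeg_split (ends : E → V × V) (o : E → Bool) (S : Finset E) (v : V) :
    (mdeg ends S v : ℤ) = (∑ e ∈ S, if OD.tl ends o e = v then (1 : ℤ) else 0) +
      ∑ e ∈ S, if OD.hd ends o e = v then (1 : ℤ) else 0 := by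
  rw [mdeg_int, ← Finset.sum_add_distrib, ← Finset.sum_add_distrib]
  refine Finset.sum_congr rfl fun e _ => ?_
  unfold OD.tl OD.hd
  cases o e <;> simp [add_comm]

theorem exists_orientation [Fintype V] [Fintype E] (ends : E → V × V) (k : ℕ) (hk : Nat.Prime k)
    (hconn : EdgeConn ends (3 * k - 3))
    (hcop : k - 1 ≤ (univ.filter fun v : V => Nat.Coprime (mdeg ends univ v) k).card) :
    ∃ o : E → Bool, ∀ v, (k : ℤ) ∣ (∑ e, if OD.tl ends o e = v then (1 : ℤ) else 0) ∨
      (k : ℤ) ∣ ∑ e, if OD.hd ends o e = v then (1 : ℤ) else 0 := by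
  by_cases hV : Nonempty V
  swap
  · exact ⟨fun _ => true, fun v => absurd ⟨v⟩ hV⟩
  obtain ⟨v0⟩ := hV
  have hk2 : 2 ≤ (k : ℤ) := by exact_mod_cast hk.two_le
  haveI : Fact k.Prime := ⟨hk⟩
  obtain ⟨T, hT, hsum⟩ := subset_sums hk (fun v => ((mdeg ends univ v : ℕ) : ZMod k))
    (univ.filter fun v : V => Nat.Coprime (mdeg ends univ v) k) (by
      intro v hv h0
      rw [Finset.mem_filter] at hv
      rw [ZMod.natCast_eq_zero_iff] at h0
      exact hk.one_lt.ne' (Nat.eq_one_of_dvd_coprimes hv.2 h0 dvd_rfl)) hcop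
    ((Fintype.card E : ℕ) : ZMod k)
  let I : OD V E :=
    { ends := ends, F := univ, U := univ, r := fun v => if v ∈ T then (mdeg ends univ v : ℤ) else 0,
      a := fun _ => 0, b := fun _ => 0 }
  have hI : OD.Inst (k : ℤ) I v0 := by
    refine ⟨fun e _ => ⟨Finset.mem_univ _, Finset.mem_univ _⟩, fun _ => le_rfl, fun _ => le_rfl,
      ?_, ?_, ?_⟩
    · left
      simp [I]
      omega
    · have e1 : ∑ v ∈ I.U, I.r v = ∑ v ∈ T, (mdeg ends univ v : ℤ) := by
        simp [I]
      have e2 : (#I.F : ℤ) = (Fintype.card E : ℤ) := by simp [I]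
      rw [e1, e2, ← ZMod.intCast_zmod_eq_zero_iff_dvd]
      push_cast
      rw [hsum, sub_self]
    · intro S _ hne hnu
      left
      have hc := hconn S hne hnu
      have e1 := I.X_add_Y S
      have e2 : (∑ e ∈ I.F, if ((I.ends e).1 ∈ S ∧ (I.ends e).2 ∉ S) ∨
          ((I.ends e).1 ∉ S ∧ (I.ends e).2 ∈ S) then (1 : ℤ) else 0) = (cutCard ends S : ℤ) := by
        unfold cutCard
        rw [Finset.card_filter]
        push_cast
        rfl
      have e3 : ∑ v ∈ S, I.a v = 0 := by simp [I]
      have e4 : ∑ v ∈ S, I.b v = 0 := by simp [I]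
      rw [e2, e3] at e1
      try rw [e4] at e1
      have hc' : 3 * (k : ℤ) - 3 ≤ cutCard ends S := by omega
      refine ⟨-((I.X S - (k - 1)) / k), ?_, ?_⟩
      · have h1 := Int.emod_nonneg (I.X S - (k - 1)) (show (k : ℤ) ≠ 0 by omega)
        have h3 := Int.emod_add_mul_ediv (I.X S - (k - 1)) (k : ℤ)
        linarith
      · have h2 := Int.emod_lt_of_pos (I.X S - (k - 1)) (show (0 : ℤ) < k by omega)
        have h3 := Int.emod_add_mul_ediv (I.X S - (k - 1)) (k : ℤ)
        linarith
  obtain ⟨o, ho⟩ := OD.main hk2 _ _ I v0 rfl rfl hI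
  refine ⟨o, fun v => ?_⟩
  have h1 := ho v (Finset.mem_univ _)
  have h2 := mdeg_split ends o univ v
  have e1 : (∑ e ∈ I.F, if OD.tl I.ends o e = v then (1 : ℤ) else 0) =
    ∑ e, if OD.tl ends o e = v then (1 : ℤ) else 0 := rfl
  have e2 : I.r v = if v ∈ T then (mdeg ends univ v : ℤ) else 0 := rfl
  rw [e1, e2] at h1
  by_cases hv : v ∈ T
  · right
    rw [if_pos hv] at h1
    rw [← dvd_neg]
    refine h1.trans (dvd_of_eq ?_)
    linarith
  · left
    rw [if_neg hv, sub_zero] at h1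
    exact h1

theorem sum_classes [Fintype E] {k : ℕ} (c : E → Fin k) (p : E → Prop) [DecidablePred p] :
    ∑ i, (∑ e, if p e ∧ c e = i then (1 : ℤ) else 0) = ∑ e, if p e then (1 : ℤ) else 0 := by
  rw [Finset.sum_comm]
  refine Finset.sum_congr rfl fun e _ => ?_
  by_cases h : p e <;> simp [h]

theorem sum_class_filter [Fintype E] {k : ℕ} (c : E → Fin k) (p : E → Prop) [DecidablePred p]
    (i : Fin k) : ∑ e ∈ univ.filter (fun e => c e = i), (if p e then (1 : ℤ) else 0) =
      ∑ e, if p e ∧ c e = i then (1 : ℤ) else 0 := by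
  rw [Finset.sum_filter]
  refine Finset.sum_congr rfl fun e _ => ?_
  by_cases h : p e <;> simp [h]

end final

/-- Equitable factorization of `(3k−3)`-edge-connected multigraphs for prime `k`, when
at least `k−1` vertices have degree coprime with `k`. -/
theorem equitable_factorization_prime [Fintype V] [Fintype E] [DecidableEq V]
    (ends : E → V × V) (k : ℕ) (hk : Nat.Prime k)
    (hconn : EdgeConn ends (3 * k - 3))
    (hcop : k - 1 ≤ (univ.filter fun v : V => Nat.Coprime (mdeg ends univ v) k).card) :
    ∃ c : E → Fin k,
      (∀ i : Fin k,
        |(((univ.filter fun e : E => c e = i).card : ℝ)) -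
          (Fintype.card E : ℝ) / (k : ℝ)| < 1) ∧
      (∀ v : V, ∀ i : Fin k,
        |((mdeg ends (univ.filter fun e => c e = i) v : ℝ)) -
          (mdeg ends univ v : ℝ) / (k : ℝ)| < 1) := by
  classical
  obtain ⟨o, ho⟩ := exists_orientation ends k hk hconn hcop
  obtain ⟨c, c1, c2, c3⟩ := k_colour_graph (OD.tl ends o) (OD.hd ends o) hk.pos
  refine ⟨c, fun i => ?_, fun v i => ?_⟩
  · have h := avg_lt (fun i => ∑ e, if c e = i then (1 : ℤ) else 0) c1 i
    have e1 : ∑ j, (∑ e, if c e = j then (1 : ℤ) else 0) = (Fintype.card E : ℤ) := by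
      rw [Finset.sum_comm]; simp
    have e2 : (∑ e, if c e = i then (1 : ℤ) else 0) =
        ((univ.filter fun e : E => c e = i).card : ℤ) := by simp
    simp only [e1] at h
    rw [e2] at h
    simpa only [Int.cast_natCast] using h
  · set x : Fin k → ℤ := fun i => (mdeg ends (univ.filter fun e => c e = i) v : ℤ) with hx
    have hsplit : ∀ i, x i = (∑ e, if OD.tl ends o e = v ∧ c e = i then (1 : ℤ) else 0) +
        ∑ e, if OD.hd ends o e = v ∧ c e = i then (1 : ℤ) else 0 := by
      intro i
      simp only [hx]
      rw [mdeg_split ends o, sum_class_filter, sum_class_filter]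
    have hsum : ∑ j, x j = (mdeg ends univ v : ℤ) := by
      rw [mdeg_split ends o, Finset.sum_congr rfl fun j _ => hsplit j, Finset.sum_add_distrib,
        sum_classes, sum_classes]
    have hdiff : ∀ i j, x i - x j ≤ 1 := by
      intro i j
      rw [hsplit, hsplit]
      have a2 := c2 v i j
      have a3 := c3 v i j
      rcases ho v with h | h
      · have := avg_eq _ (c2 v) (by rw [sum_classes]; exact h) i j
        linarith
      · have := avg_eq _ (c3 v) (by rw [sum_classes]; exact h) i j
        linarith
    have h := avg_lt x hdiff i
    rw [hsum] at h
    simpa only [hx, Int.cast_natCast] using h
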